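/- arXiv:2307.06160 — 3 statements merged into one kernel-verified Lean document; each statement's English description precedes it below -/
import Mathlib

section
/- The number of maximal isotropic subspaces defined over F_{q^2} (Hermitian m-planes) of a nondegenerate Hermitian form on an F_{q^2}-vector space of dimension 2m+2 equals ∏_{i=0}^{m} (q^{2i+1} + 1). Equivalently, the smooth q-bic hypersurface of even dimension 2m over an algebraically closed field contains exactly ∏_{i=0}^{m} (q^{2i+1}+1) m-planes. -/
/-- `h` is a nondegenerate Hermitian form with respect to `c ↦ c ^ q`, conjugate-linear in its
first argument. -/
structure IsHermitianForm {K W : Type*} [Field K] [AddCommGroup W] [Module K W]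
    (q : ℕ) (h : W → W → K) : Prop where
  add_left : ∀ x y z : W, h (x + y) z = h x z + h y z
  add_right : ∀ x y z : W, h x (y + z) = h x y + h x z
  smul_left : ∀ (c : K) (x y : W), h (c • x) y = c ^ q * h x y
  smul_right : ∀ (c : K) (x y : W), h x (c • y) = c * h x y
  symm : ∀ x y : W, h x y = (h y x) ^ q
  nondegenerate : ∀ x : W, (∀ y : W, h x y = 0) → x = 0

section FiniteField

variable {K : Type*} [Field K] [Fintype K]

theorem add_pow_of_card_eq_sq {p q ν : ℕ} [Fact p.Prime] (hq : q = p ^ ν)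
    (hcard : Fintype.card K = q ^ 2) (x y : K) : (x + y) ^ q = x ^ q + y ^ q := by
  have hp : (p : K) = 0 := by
    have h0 : ((Fintype.card K : ℕ) : K) = 0 := Nat.cast_card_eq_zero K
    rw [hcard, hq] at h0
    push_cast at h0
    exact eq_zero_of_pow_eq_zero (eq_zero_of_pow_eq_zero h0)
  have : CharP K p := by
    have h1 := (CharP.cast_eq_zero_iff K (ringChar K) p).1 hp
    have h2 := (Nat.dvd_prime (Fact.out : p.Prime)).1 h1
    rcases h2 with h2 | h2
    · exact absurd h2 (CharP.ringChar_ne_one)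
    · rw [← h2]; infer_instance
  rw [hq, add_pow_char_pow]

theorem card_pow_add_self_fiber {q : ℕ} (hq : 2 ≤ q) (hcard : Fintype.card K = q ^ 2)
    (hadd : ∀ x y : K, (x + y) ^ q = x ^ q + y ^ q) {c : K} (hc : c ^ q = c) :
    Nat.card {t : K // t ^ q + t = c} = q := by
  classical
  have hqq : ∀ x : K, (x ^ q) ^ q = x := fun x => by
    rw [← pow_mul, ← sq, ← hcard, FiniteField.pow_card]
  let f : K →+ K :=
    { toFun := fun t => t ^ q + t
      map_zero' := by simp; omega
      map_add' := fun x y => by simp only [hadd]; ring }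
  have hroots : ∀ (P : Polynomial K), P.natDegree = q → ∀ S : Set K, (∀ x ∈ S, P.IsRoot x) →
      Nat.card S ≤ q := by
    intro P hP S hS
    have hP0 : P ≠ 0 := by rintro rfl; simp at hP; omega
    have hsub : S ⊆ (P.roots.toFinset : Set K) := fun x hx => by
      simpa [hP0] using hS x hx
    calc Nat.card S ≤ Nat.card (P.roots.toFinset : Set K) :=
          Nat.card_mono (Finset.finite_toSet _) hsub
      _ = P.roots.toFinset.card := by rw [Nat.card_coe_set_eq, Set.ncard_coe_finset]
      _ ≤ P.roots.card := Multiset.toFinset_card_le _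
      _ ≤ q := hP ▸ P.card_roots'
  have hker : Nat.card f.ker ≤ q := by
    refine hroots (Polynomial.X ^ q + Polynomial.X) ?_ f.ker ?_
    · rw [Polynomial.natDegree_add_eq_left_of_natDegree_lt] <;> simp; omega
    · intro x hx
      have : x ^ q + x = 0 := hx
      simpa [Polynomial.IsRoot] using this
  have hfix : Nat.card {y : K | y ^ q = y} ≤ q := by
    refine hroots (Polynomial.X ^ q - Polynomial.X) ?_ _ ?_
    · rw [Polynomial.natDegree_sub_eq_left_of_natDegree_lt] <;> simp; omega
    · intro x hx
      have : x ^ q = x := hx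
      simp [Polynomial.IsRoot, this]
  have hsub : (f.range : Set K) ⊆ {y : K | y ^ q = y} := by
    rintro _ ⟨t, rfl⟩
    change (t ^ q + t) ^ q = t ^ q + t
    rw [hadd, hqq, add_comm]
  have hrange : Nat.card f.range ≤ Nat.card {y : K | y ^ q = y} :=
    Nat.card_mono (Set.toFinite _) hsub
  have hprod : Nat.card f.ker * Nat.card f.range = q * q := by
    rw [← sq, ← hcard, ← Nat.card_eq_fintype_card, ← AddSubgroup.index_ker,
      AddSubgroup.card_mul_index]
  have hker' : Nat.card f.ker = q := by nlinarith
  have hrange' : Nat.card f.range = q := by nlinarith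
  have heq : (f.range : Set K) = {y : K | y ^ q = y} :=
    Set.eq_of_subset_of_ncard_le hsub (by
      rw [← Nat.card_coe_set_eq, ← Nat.card_coe_set_eq]
      exact hfix.trans hrange'.ge) (Set.toFinite _)
  obtain ⟨t₀, ht₀⟩ : c ∈ (f.range : Set K) := heq ▸ hc
  refine Eq.trans (Nat.card_congr ((Equiv.subRight t₀).subtypeEquiv fun t => ?_)) hker'
  rw [Equiv.subRight_apply, AddMonoidHom.mem_ker, map_sub, ht₀, sub_eq_zero]
  rfl

theorem exists_pow_succ_eq {q : ℕ} (hq : 2 ≤ q) (hcard : Fintype.card K = q ^ 2)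
    {c : K} (hc0 : c ≠ 0) (hc : c ^ q = c) : ∃ t : K, t ^ (q + 1) = c := by
  classical
  obtain ⟨g, hg⟩ := IsCyclic.exists_generator (α := Kˣ)
  obtain ⟨i, hi⟩ := (mem_powers_iff_mem_zpowers.2 (hg (Units.mk0 c hc0)))
  have hi : g ^ i = Units.mk0 c hc0 := hi
  have hord : orderOf g = (q + 1) * (q - 1) := by
    rw [orderOf_eq_card_of_forall_mem_zpowers hg, Nat.card_eq_fintype_card, Fintype.card_units,
      hcard]
    simpa using Nat.sq_sub_sq q 1
  have h1 : g ^ (i * (q - 1)) = 1 := by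
    rw [pow_mul, hi]
    ext
    simp only [Units.val_pow_eq_pow_val, Units.val_mk0, Units.val_one]
    refine mul_left_cancel₀ hc0 ?_
    rw [mul_one, ← pow_succ', Nat.sub_add_cancel (by omega), hc]
  have h2 := orderOf_dvd_of_pow_eq_one h1
  rw [hord] at h2
  obtain ⟨j, rfl⟩ := Nat.dvd_of_mul_dvd_mul_right (by omega) h2
  refine ⟨((g ^ j : Kˣ) : K), ?_⟩
  rw [← Units.val_pow_eq_pow_val, ← pow_mul, mul_comm, hi, Units.val_mk0]

end FiniteField

namespace IsHermitianForm

variable {K W : Type*} [Field K] [AddCommGroup W] [Module K W] {q : ℕ} {h : W → W → K}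

theorem zero_left (H : IsHermitianForm q h) (y : W) : h 0 y = 0 := by
  simpa using H.add_left 0 0 y

theorem zero_right (H : IsHermitianForm q h) (x : W) : h x 0 = 0 := by
  simpa using H.add_right x 0 0

theorem neg_right (H : IsHermitianForm q h) (x y : W) : h x (-y) = -h x y := by
  simpa using H.smul_right (-1) x y

theorem sub_right (H : IsHermitianForm q h) (x y z : W) : h x (y - z) = h x y - h x z := by
  rw [sub_eq_add_neg, H.add_right, H.neg_right, sub_eq_add_neg]

theorem eq_zero_symm (H : IsHermitianForm q h) (hq : q ≠ 0) {x y : W} (hxy : h x y = 0) :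
    h y x = 0 := by
  rw [H.symm, hxy, zero_pow hq]

theorem exists_eq_one (H : IsHermitianForm q h) {v : W} (hv : v ≠ 0) : ∃ w, h v w = 1 := by
  obtain ⟨y, hy⟩ : ∃ y, h v y ≠ 0 := by
    by_contra! hcon
    exact hv (H.nondegenerate v hcon)
  exact ⟨(h v y)⁻¹ • y, by rw [H.smul_right, inv_mul_cancel₀ hy]⟩

/-- The linear functional `h x`. -/
def toLin (H : IsHermitianForm q h) (x : W) : W →ₗ[K] K where
  toFun := h x
  map_add' := H.add_right x
  map_smul' c y := H.smul_right c x y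

/-- The orthogonal complement of a pair of vectors. -/
def perp (H : IsHermitianForm q h) (v w : W) : Submodule K W :=
  LinearMap.ker ((H.toLin v).prod (H.toLin w))

theorem mem_perp (H : IsHermitianForm q h) {v w x : W} :
    x ∈ H.perp v w ↔ h v x = 0 ∧ h w x = 0 := by
  simp [perp, toLin]

section HyperbolicPair

variable {v w : W}

theorem symm_eq_one (H : IsHermitianForm q h) (hvw : h v w = 1) : h w v = 1 := by
  rw [H.symm, hvw, one_pow]

theorem sub_mem_perp (H : IsHermitianForm q h) (hv : h v v = 0) (hvw : h v w = 1) (x : W) :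
    x - (h w x - h v x * h w w) • v - h v x • w ∈ H.perp v w := by
  rw [mem_perp]
  simp only [H.sub_right, H.smul_right, hv, hvw, H.symm_eq_one hvw]
  constructor <;> ring

theorem finrank_perp [Finite K] [Finite W] (H : IsHermitianForm q h) (hv : h v v = 0)
    (hvw : h v w = 1) : Module.finrank K (H.perp v w) + 2 = Module.finrank K W := by
  have hsurj : Function.Surjective ((H.toLin v).prod (H.toLin w)) := by
    rintro ⟨a, b⟩
    refine ⟨(b - a * h w w) • v + a • w, ?_⟩
    simp only [toLin, LinearMap.prod_apply, Function.prod_apply, LinearMap.coe_mk, AddHom.coe_mk,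
      H.add_right, H.smul_right, hv, hvw, H.symm_eq_one hvw, Prod.mk.injEq]
    constructor <;> ring
  have h1 := LinearMap.finrank_range_add_finrank_ker ((H.toLin v).prod (H.toLin w))
  rw [LinearMap.range_eq_top.2 hsurj, finrank_top, Module.finrank_prod,
    Module.finrank_self] at h1
  rw [← h1, perp]
  omega

theorem restrict_perp (H : IsHermitianForm q h) (hq : q ≠ 0) (hv : h v v = 0)
    (hvw : h v w = 1) : IsHermitianForm q (fun x y : H.perp v w => h x y) where
  add_left x y z := H.add_left x y z
  add_right x y z := H.add_right x y z
  smul_left c x y := H.smul_left c x y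
  smul_right c x y := H.smul_right c x y
  symm x y := H.symm x y
  nondegenerate x hx := by
    refine Subtype.ext (H.nondegenerate x fun y => ?_)
    obtain ⟨hx1, hx2⟩ := H.mem_perp.1 x.2
    have := hx ⟨_, H.sub_mem_perp hv hvw y⟩
    simpa only [H.sub_right, H.smul_right, H.eq_zero_symm hq hx1, H.eq_zero_symm hq hx2,
      mul_zero, sub_zero] using this

/-- A hyperbolic pair and its orthogonal complement give coordinates on the whole space. -/
def coordEquiv (H : IsHermitianForm q h) (hv : h v v = 0) (hvw : h v w = 1) :
    W ≃ (K × H.perp v w) × K where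
  toFun x := ((h v x, ⟨_, H.sub_mem_perp hv hvw x⟩), h w x - h v x * h w w)
  invFun z := z.2 • v + z.1.1 • w + z.1.2
  left_inv x := by simp
  right_inv := by
    rintro ⟨⟨b, x, hx⟩, a⟩
    obtain ⟨hx1, hx2⟩ := H.mem_perp.1 hx
    have h1 : h v (a • v + b • w + x) = b := by
      simp only [H.add_right, H.smul_right, hv, hvw, hx1]; ring
    have h2 : h w (a • v + b • w + x) = a + b * h w w := by
      simp only [H.add_right, H.smul_right, H.symm_eq_one hvw, hx2]; ring
    simp only [h1, h2, Prod.mk.injEq, Subtype.mk.injEq, true_and]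
    constructor
    · simp only [add_sub_cancel_right]; abel
    · ring

theorem coordEquiv_symm_self (H : IsHermitianForm q h) (hq : q ≠ 0) (hv : h v v = 0)
    (hvw : h v w = 1) (b : K) (x : H.perp v w) (a : K) :
    h ((H.coordEquiv hv hvw).symm ((b, x), a)) ((H.coordEquiv hv hvw).symm ((b, x), a)) =
      a ^ q * b + b ^ q * a + (b ^ q * b * h w w + h x x) := by
  obtain ⟨hx1, hx2⟩ := H.mem_perp.1 x.2
  simp only [coordEquiv, Equiv.coe_fn_symm_mk, H.add_right, H.add_left, H.smul_right,
    H.smul_left, hv, hvw, H.symm_eq_one hvw, hx1, hx2, H.eq_zero_symm hq hx1,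
    H.eq_zero_symm hq hx2]
  ring

/-- Isotropic subspaces through `v` correspond to isotropic subspaces of the complement of a
hyperbolic pair. -/
def isotropicEquiv [Finite W] (H : IsHermitianForm q h) (hq : q ≠ 0) (hv : h v v = 0)
    (hvw : h v w = 1) (k : ℕ) :
    {U : Submodule K W // (Module.finrank K U = k + 1 ∧ ∀ x ∈ U, ∀ y ∈ U, h x y = 0) ∧ v ∈ U} ≃
    {U : Submodule K (H.perp v w) // Module.finrank K U = k ∧
      ∀ x ∈ U, ∀ y ∈ U, h (x : W) y = 0} := by
  have hv0 : v ≠ 0 := by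
    rintro rfl
    simp [H.zero_left] at hvw
  have hrank : ∀ U : Submodule K (H.perp v w),
      Module.finrank K ((K ∙ v) ⊔ U.map (H.perp v w).subtype : Submodule K W) =
        Module.finrank K U + 1 := by
    intro U
    have hdisj : (K ∙ v) ⊓ U.map (H.perp v w).subtype = ⊥ := by
      rw [eq_bot_iff]
      rintro x ⟨hx1, hx2⟩
      obtain ⟨a, rfl⟩ := Submodule.mem_span_singleton.1 hx1
      obtain ⟨y, -, hy⟩ := hx2
      have h2 := (H.mem_perp.1 y.2).2
      rw [Submodule.subtype_apply] at hy
      rw [hy, H.smul_right, H.symm_eq_one hvw, mul_one] at h2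
      simp [h2]
    have := Submodule.finrank_sup_add_finrank_inf_eq (K ∙ v) (U.map (H.perp v w).subtype)
    rw [hdisj, finrank_bot, finrank_span_singleton hv0,
      Submodule.finrank_map_subtype_eq] at this
    omega
  have hcomap : ∀ U : Submodule K (H.perp v w),
      ((K ∙ v) ⊔ U.map (H.perp v w).subtype).comap (H.perp v w).subtype = U := by
    intro U
    ext x
    rw [Submodule.mem_comap, Submodule.mem_sup]
    constructor
    · rintro ⟨y, hy, z, ⟨z, hz, rfl⟩, hyz⟩
      obtain ⟨a, rfl⟩ := Submodule.mem_span_singleton.1 hy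
      have h2 := (H.mem_perp.1 x.2).2
      rw [Submodule.subtype_apply, Submodule.subtype_apply] at hyz
      rw [← hyz, H.add_right, H.smul_right, H.symm_eq_one hvw, (H.mem_perp.1 z.2).2, mul_one,
        add_zero] at h2
      rw [h2, zero_smul, zero_add] at hyz
      rwa [← Subtype.ext hyz]
    · exact fun hx => ⟨0, zero_mem _, x, ⟨x, hx, rfl⟩, zero_add _⟩
  have hmap : ∀ U : Submodule K W, (∀ x ∈ U, ∀ y ∈ U, h x y = 0) → v ∈ U →
      (K ∙ v) ⊔ (U.comap (H.perp v w).subtype).map (H.perp v w).subtype = U := by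
    intro U hU hvU
    apply le_antisymm
    · rw [sup_le_iff, Submodule.span_singleton_le_iff_mem]
      exact ⟨hvU, Submodule.map_comap_le _ _⟩
    · intro x hx
      have hmem := H.sub_mem_perp hv hvw x
      rw [hU v hvU x hx, zero_smul, zero_mul, sub_zero, sub_zero] at hmem
      rw [Submodule.mem_sup]
      exact ⟨h w x • v, Submodule.mem_span_singleton.2 ⟨_, rfl⟩, x - h w x • v,
        ⟨⟨_, hmem⟩, U.sub_mem hx (U.smul_mem _ hvU), rfl⟩, by abel⟩
  exact
  { toFun := fun U => ⟨U.1.comap (H.perp v w).subtype, by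
      have h1 := hrank (U.1.comap (H.perp v w).subtype)
      rw [hmap U.1 U.2.1.2 U.2.2, U.2.1.1] at h1
      omega, fun x hx y hy => U.2.1.2 x hx y hy⟩
    invFun := fun U => ⟨(K ∙ v) ⊔ U.1.map (H.perp v w).subtype, ⟨by rw [hrank, U.2.1], by
      intro x hx y hy
      obtain ⟨x₁, hx₁, _, ⟨x₂, hx₂, rfl⟩, rfl⟩ := Submodule.mem_sup.1 hx
      obtain ⟨y₁, hy₁, _, ⟨y₂, hy₂, rfl⟩, rfl⟩ := Submodule.mem_sup.1 hy
      obtain ⟨a, rfl⟩ := Submodule.mem_span_singleton.1 hx₁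
      obtain ⟨b, rfl⟩ := Submodule.mem_span_singleton.1 hy₁
      simp only [Submodule.subtype_apply, H.add_right, H.add_left, H.smul_right, H.smul_left, hv,
        (H.mem_perp.1 y₂.2).1, H.eq_zero_symm hq (H.mem_perp.1 x₂.2).1, U.2.2 x₂ hx₂ y₂ hy₂]
      ring⟩, (le_sup_left : (K ∙ v) ≤ _) (Submodule.mem_span_singleton_self v)⟩
    left_inv := fun U => Subtype.ext (hmap U.1 U.2.1.2 U.2.2)
    right_inv := fun U => Subtype.ext (hcomap U.1) }

end HyperbolicPair

variable [Fintype K]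

theorem exists_isotropic [Finite W] (H : IsHermitianForm q h) (hq : 2 ≤ q)
    (hcard : Fintype.card K = q ^ 2) (hdim : 2 ≤ Module.finrank K W) :
    ∃ v : W, v ≠ 0 ∧ h v v = 0 := by
  by_contra! hcon
  have : Nontrivial W := Module.nontrivial_of_finrank_pos (R := K) (by omega)
  obtain ⟨x, hx⟩ := exists_ne (0 : W)
  have hxx := hcon x hx
  obtain ⟨y, hy, hy0⟩ : ∃ y ∈ LinearMap.ker (H.toLin x), y ≠ 0 := by
    refine Submodule.exists_mem_ne_zero_of_ne_bot fun hbot => ?_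
    have h1 := LinearMap.finrank_range_add_finrank_ker (H.toLin x)
    have h2 := Submodule.finrank_le (LinearMap.range (H.toLin x))
    rw [hbot, finrank_bot] at h1
    rw [Module.finrank_self] at h2
    omega
  have hxy : h x y = 0 := hy
  have hyy := hcon y hy0
  have hc0 : h x x / h y y ≠ 0 := div_ne_zero hxx hyy
  have hneg : (-1 : K) ^ q = -1 := by
    have h2 := H.smul_left (-1) x x
    have h3 := H.add_left x ((-1 : K) • x) x
    rw [h2] at h3
    simp only [neg_smul, one_smul, add_neg_cancel, H.zero_left] at h3
    have h4 : (1 + (-1 : K) ^ q) * h x x = 0 := by linear_combination -h3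
    have := (mul_eq_zero.1 h4).resolve_right hxx
    linear_combination this
  obtain ⟨t, ht⟩ := exists_pow_succ_eq hq hcard (c := -1 * (h x x / h y y))
    (mul_ne_zero (by simp) hc0) (by
      rw [mul_pow, hneg, div_pow, ← H.symm, ← H.symm])
  have hiso : h (x + t • y) (x + t • y) = 0 := by
    simp only [H.add_left, H.add_right, H.smul_left, H.smul_right, hxy,
      H.eq_zero_symm (by omega) hxy]
    have : t ^ q * t = -1 * (h x x / h y y) := by rw [← pow_succ, ht]
    field_simp at this
    linear_combination this
  have hne : x + t • y ≠ 0 := by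
    intro h0
    have := H.zero_right x
    rw [← h0, H.add_right, H.smul_right, hxy, mul_zero, add_zero] at this
    exact hxx this
  exact hcon _ hne hiso

theorem card_isotropic_vectors_recursion [Finite W] (H : IsHermitianForm q h) (hq : 2 ≤ q)
    (hcard : Fintype.card K = q ^ 2) (hadd : ∀ x y : K, (x + y) ^ q = x ^ q + y ^ q)
    {v w : W} (hv : h v v = 0) (hvw : h v w = 1) :
    Nat.card {x : W // h x x = 0} =
      q ^ 2 * Nat.card {x : H.perp v w // h (x : W) x = 0} +
        (q ^ 2 - 1) * (Nat.card (H.perp v w) * q) := by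
  classical
  have hq0 : q ≠ 0 := by omega
  have := Fintype.ofFinite (H.perp v w)
  have hfix : ∀ z : W, (h z z) ^ q = h z z := fun z => (H.symm z z).symm
  have hneg : ∀ z : K, z ^ q = z → (-z) ^ q = -z := fun z hz => by
    have h1 := hadd z (-z)
    rw [add_neg_cancel, zero_pow hq0, hz] at h1
    linear_combination -h1
  have hfiber : ∀ (b : K) (x : H.perp v w),
      Nat.card {a : K // a ^ q * b + b ^ q * a + (b ^ q * b * h w w + h x x) = 0} =
        if b = 0 then (if h (x : W) x = 0 then q ^ 2 else 0) else q := by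
    intro b x
    by_cases hb : b = 0
    · subst hb
      by_cases hx : h (x : W) x = 0
      · simp [hx, hq0, hcard]
      · simp [hx, hq0]
    · rw [if_neg hb]
      have hbq : (b ^ q) ^ q = b := by rw [← pow_mul, ← sq, ← hcard, FiniteField.pow_card]
      have hbb : (b ^ q * b * h w w) ^ q = b ^ q * b * h w w := by
        rw [mul_pow, mul_pow, hbq, hfix]; ring
      have hcc := hneg (b ^ q * b * h w w + h x x) (by rw [hadd, hbb, hfix])
      refine Eq.trans (Nat.card_congr
        ((Equiv.mulLeft₀ (b ^ q) (pow_ne_zero q hb)).subtypeEquiv fun a => ?_))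
        (card_pow_add_self_fiber hq hcard hadd hcc)
      rw [Equiv.mulLeft₀_apply, mul_pow, hbq, eq_neg_iff_add_eq_zero, mul_comm b]
  have e : {x : W // h x x = 0} ≃ (Σ z : K × H.perp v w,
      {a : K // a ^ q * z.1 + z.1 ^ q * a + (z.1 ^ q * z.1 * h w w + h z.2 z.2) = 0}) :=
    ((H.coordEquiv hv hvw).symm.subtypeEquiv (fun z => by
      rw [← H.coordEquiv_symm_self hq0 hv hvw])).symm.trans
      (Equiv.subtypeProdEquivSigmaSubtype fun (z : K × H.perp v w) (a : K) =>
        a ^ q * z.1 + z.1 ^ q * a + (z.1 ^ q * z.1 * h w w + h z.2 z.2) = 0)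
  rw [Nat.card_congr e, Nat.card_sigma]
  simp only [hfiber]
  rw [Fintype.sum_prod_type, ← Finset.add_sum_erase _ _ (Finset.mem_univ (0 : K))]
  congr 1
  · simp only [if_true]
    rw [← Finset.sum_filter, Finset.sum_const, Nat.card_eq_fintype_card, Fintype.card_subtype,
      smul_eq_mul, mul_comm]
  · rw [Finset.sum_congr rfl (g := fun _ => Nat.card (H.perp v w) * q)]
    · simp [Finset.card_erase_of_mem, hcard]
    · intro b hb
      simp [Finset.ne_of_mem_erase hb]

end IsHermitianForm

theorem card_eq_sq_pow_finrank {K : Type*} [Field K] [Fintype K] {q : ℕ}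
    (hcard : Fintype.card K = q ^ 2) (W : Type*) [AddCommGroup W] [Module K W] [Finite W] :
    Nat.card W = q ^ (2 * Module.finrank K W) := by
  rw [Module.natCard_eq_pow_finrank (K := K), Nat.card_eq_fintype_card, hcard, pow_mul]

universe u

theorem IsHermitianForm.card_isotropic_vectors {K : Type*} [Field K] [Fintype K] {q : ℕ}
    (hq : 2 ≤ q) (hcard : Fintype.card K = q ^ 2)
    (hadd : ∀ x y : K, (x + y) ^ q = x ^ q + y ^ q) (k : ℕ) :
    ∀ {W : Type u} [AddCommGroup W] [Module K W] [Finite W] {h : W → W → K},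
      IsHermitianForm q h → Module.finrank K W = 2 * k →
      q * Nat.card {x : W // h x x = 0} + q ^ (2 * k) = q ^ (4 * k) + q ^ (2 * k + 1) := by
  induction k with
  | zero =>
    intro W _ _ _ h H hdim
    have : Subsingleton W := Module.finrank_zero_iff.1 (by simpa using hdim)
    have : Unique {x : W // h x x = 0} :=
      ⟨⟨⟨0, H.zero_left 0⟩⟩, fun x => Subtype.ext (Subsingleton.elim _ _)⟩
    simp [add_comm]
  | succ k ih =>
    intro W _ _ _ h H hdim
    obtain ⟨v, hv0, hv⟩ := H.exists_isotropic hq hcard (by omega)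
    obtain ⟨w, hvw⟩ := H.exists_eq_one hv0
    have hd : Module.finrank K (H.perp v w) = 2 * k := by
      have := H.finrank_perp hv hvw
      omega
    have h1 := ih (H.restrict_perp (by omega) hv hvw) hd
    rw [H.card_isotropic_vectors_recursion hq hcard hadd hv hvw,
      card_eq_sq_pow_finrank hcard (H.perp v w), hd]
    have hq2 : 1 ≤ q ^ 2 := Nat.one_le_pow _ _ (by omega)
    zify [hq2] at h1 ⊢
    rw [show 2 * (2 * k) = 4 * k by ring]
    linear_combination (q : ℤ) ^ 2 * h1

theorem IsHermitianForm.card_maximal_isotropic {K : Type*} [Field K] [Fintype K] {q : ℕ}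
    (hq : 2 ≤ q) (hcard : Fintype.card K = q ^ 2)
    (hadd : ∀ x y : K, (x + y) ^ q = x ^ q + y ^ q) (k : ℕ) :
    ∀ {W : Type u} [AddCommGroup W] [Module K W] [Finite W] {h : W → W → K},
      IsHermitianForm q h → Module.finrank K W = 2 * k →
      Nat.card {U : Submodule K W // Module.finrank K U = k ∧ ∀ x ∈ U, ∀ y ∈ U, h x y = 0} =
        ∏ i ∈ Finset.range k, (q ^ (2 * i + 1) + 1) := by
  induction k with
  | zero =>
    intro W _ _ _ h H hdim
    have : Subsingleton W := Module.finrank_zero_iff.1 (by simpa using hdim)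
    have : Unique {U : Submodule K W // Module.finrank K U = 0 ∧
        ∀ x ∈ U, ∀ y ∈ U, h x y = 0} :=
      ⟨⟨⟨⊥, by simp, fun x _ y _ => by rw [Subsingleton.elim x 0, H.zero_left]⟩⟩,
        fun x => Subtype.ext (Subsingleton.elim _ _)⟩
    rw [Nat.card_unique, Finset.prod_range_zero]
  | succ k ih =>
    intro W _ _ _ h H hdim
    classical
    have hq0 : q ≠ 0 := by omega
    let M := {U : Submodule K W // Module.finrank K U = k + 1 ∧ ∀ x ∈ U, ∀ y ∈ U, h x y = 0}
    let Z := {x : W // h x x = 0 ∧ x ≠ 0}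
    have := Fintype.ofFinite M
    have := Fintype.ofFinite Z
    let e : (Σ U : M, {x : Z // (x : W) ∈ U.1}) ≃ (Σ x : Z, {U : M // (x : W) ∈ U.1}) :=
      { toFun := fun a => ⟨a.2.1, a.1, a.2.2⟩
        invFun := fun a => ⟨a.2.1, a.1, a.2.2⟩
        left_inv := fun _ => rfl
        right_inv := fun _ => rfl }
    have hleft : ∀ U : M, Nat.card {x : Z // (x : W) ∈ U.1} = q ^ (2 * (k + 1)) - 1 := by
      intro U
      have e' : {x : Z // (x : W) ∈ U.1} ≃ {x : U.1 // x ≠ 0} :=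
        { toFun := fun x => ⟨⟨x.1.1, x.2⟩, fun h0 => x.1.2.2 (congrArg Subtype.val h0)⟩
          invFun := fun x => ⟨⟨x.1.1, U.2.2 _ x.1.2 _ x.1.2, fun h0 => x.2 (Subtype.ext h0)⟩,
            x.1.2⟩
          left_inv := fun _ => rfl
          right_inv := fun _ => rfl }
      have := Fintype.ofFinite U.1
      have hcardU := card_eq_sq_pow_finrank hcard U.1
      rw [U.2.1] at hcardU
      rw [Nat.card_congr e', ← hcardU,
        Nat.card_eq_fintype_card, Nat.card_eq_fintype_card, Fintype.card_subtype_compl,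
        Fintype.card_subtype_eq]
    have hright : ∀ x : Z, Nat.card {U : M // (x : W) ∈ U.1} =
        ∏ i ∈ Finset.range k, (q ^ (2 * i + 1) + 1) := by
      rintro ⟨v, hv, hv0⟩
      obtain ⟨w, hvw⟩ := H.exists_eq_one hv0
      have hd : Module.finrank K (H.perp v w) = 2 * k := by
        have := H.finrank_perp hv hvw
        omega
      rw [← ih (H.restrict_perp hq0 hv hvw) hd]
      exact Nat.card_congr ((Equiv.subtypeSubtypeEquivSubtypeInter _ fun U => v ∈ U).trans
        (H.isotropicEquiv hq0 hv hvw k))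
    have hZ : Nat.card {x : W // h x x = 0} = Nat.card Z + 1 := by
      have e' : Z ≃ {x : {x : W // h x x = 0} // x ≠ ⟨0, H.zero_left 0⟩} :=
        (Equiv.subtypeSubtypeEquivSubtypeInter (fun x : W => h x x = 0) fun x => x ≠ 0).symm.trans
          (Equiv.subtypeEquivRight fun x => by simp only [ne_eq, Subtype.ext_iff])
      rw [Nat.card_congr e', ← Finite.card_option, Nat.card_congr (Equiv.optionSubtypeNe _)]
    have hcount := Nat.card_congr e
    rw [Nat.card_sigma, Nat.card_sigma] at hcount
    simp only [hleft, hright, Finset.sum_const, Finset.card_univ, smul_eq_mul] at hcount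
    rw [← Nat.card_eq_fintype_card, ← Nat.card_eq_fintype_card] at hcount
    have hvec := H.card_isotropic_vectors hq hcard hadd (k + 1) hdim
    rw [hZ] at hvec
    rw [Finset.prod_range_succ]
    have hlt : 1 < q ^ (2 * (k + 1)) := Nat.one_lt_pow (by omega) (by omega)
    change Nat.card M = _
    zify [hlt.le] at hcount hvec hlt ⊢
    have hqz : (q : ℤ) ≠ 0 := by exact_mod_cast hq0
    refine mul_right_cancel₀ (mul_ne_zero hqz (sub_ne_zero.2 hlt.ne')) ?_
    linear_combination (q : ℤ) * hcount +
      (∏ i ∈ Finset.range k, ((q : ℤ) ^ (2 * i + 1) + 1)) * hvec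

/-- the number of maximal isotropic subspaces (Hermitian m-planes) of a
nondegenerate Hermitian form on an F_{q²}-vector space of dimension 2m+2 equals
`∏_{i=0}^{m} (q^{2i+1} + 1)`. -/
theorem stmt_5 {p q ν m : ℕ} [Fact p.Prime] (hν : 0 < ν) (hq : q = p ^ ν)
    {K : Type*} [Field K] [Fintype K] (hcard : Fintype.card K = q ^ 2)
    {W : Type*} [AddCommGroup W] [Module K W]
    (hdim : Module.finrank K W = 2 * m + 2)
    (h : W → W → K)
    (haddl : ∀ x y z : W, h (x + y) z = h x z + h y z)
    (haddr : ∀ x y z : W, h x (y + z) = h x y + h x z)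
    (hsmull : ∀ (c : K) (x y : W), h (c • x) y = c ^ q * h x y)
    (hsmulr : ∀ (c : K) (x y : W), h x (c • y) = c * h x y)
    (hherm : ∀ x y : W, h x y = (h y x) ^ q)
    (hnd : ∀ x : W, (∀ y : W, h x y = 0) → x = 0) :
    Nat.card {U : Submodule K W // Module.finrank K U = m + 1 ∧
        ∀ u ∈ U, ∀ v ∈ U, h u v = 0}
      = ∏ i ∈ Finset.range (m + 1), (q ^ (2 * i + 1) + 1) := by
  have hq2 : 2 ≤ q := by
    rw [hq]
    exact (Fact.out : p.Prime).two_le.trans (Nat.le_self_pow hν.ne' p)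
  have : Module.Finite K W := Module.finite_of_finrank_pos (by omega)
  have : Finite W := Module.finite_of_finite K
  exact IsHermitianForm.card_maximal_isotropic hq2 hcard (add_pow_of_card_eq_sq hq hcard) (m + 1)
    ⟨haddl, haddr, hsmull, hsmulr, hherm, hnd⟩ (by omega)
end

section
/- A smooth q-bic surface in P³ (e.g., the Fermat surface of degree q+1 given by x₀^{q+1} + x₁^{q+1} + x₂^{q+1} + x₃^{q+1} = 0) over an algebraically closed field of characteristic p with q a power of p contains exactly (q+1)(q³+1) lines. -/
open Polynomial in
/-- Over an algebraically closed field, a cyclic Frobenius recursion with nonzero data has a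
nonzero solution. -/
lemma exists_frobenius_recursion {k : Type*} [Field k] [IsAlgClosed k] {Q : ℕ} (hQ : 2 ≤ Q)
    (a : ℕ → k) (m : ℕ) (ha : ∃ i ≤ m, a i ≠ 0) :
    ∃ ξ : ℕ → k, ξ m ≠ 0 ∧ ξ 0 = a 0 * ξ m ^ Q ∧
      ∀ i, ξ (i + 1) = ξ i ^ Q + a (i + 1) * ξ m ^ Q := by
  let P : ℕ → k[X] := fun i =>
    Nat.rec (C (a 0) * X ^ Q) (fun i r => r ^ Q + C (a (i + 1)) * X ^ Q) i
  have hP0 : P 0 = C (a 0) * X ^ Q := rfl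
  have hPs : ∀ i, P (i + 1) = P i ^ Q + C (a (i + 1)) * X ^ Q := fun i => rfl
  have hdvd : ∀ i, X ^ Q ∣ P i := by
    intro i
    induction i with
    | zero => exact Dvd.intro_left _ rfl
    | succ i ih =>
      rw [hPs]
      exact dvd_add (dvd_pow ih (by omega)) (Dvd.intro_left _ rfl)
  have hzero : ∀ i, P i = 0 → ∀ j ≤ i, a j = 0 := by
    intro i
    induction i with
    | zero =>
      intro h j hj
      obtain rfl : j = 0 := by omega
      simpa [hP0] using h
    | succ i ih =>
      intro h j hj
      have hc : a (i + 1) = 0 := by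
        have h1 : (P (i + 1)).coeff Q = 0 := by simp [h]
        have h2 : X ^ (Q * Q) ∣ P i ^ Q := by
          rw [pow_mul]; exact pow_dvd_pow_of_dvd (hdvd i) Q
        have h3 : (P i ^ Q).coeff Q = 0 := X_pow_dvd_iff.1 h2 Q (by nlinarith)
        simpa [hPs, h3] using h1
      rcases Nat.lt_or_ge j (i + 1) with hlt | hge
      · refine ih ?_ j (by omega)
        have : P i ^ Q = 0 := by simpa [hPs, hc] using h
        exact pow_eq_zero_iff (by omega) |>.1 this
      · obtain rfl : j = i + 1 := by omega
        exact hc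
  have hPm : P m ≠ 0 := by
    intro h
    obtain ⟨i, hi, hai⟩ := ha
    exact hai (hzero m h i hi)
  obtain ⟨R, hR⟩ := hdvd m
  have hR0 : R ≠ 0 := by rintro rfl; simp at hR; exact hPm hR
  have hdeg : (X ^ (Q - 1) * R - 1).degree ≠ 0 := by
    have h1 : 0 < (X ^ (Q - 1) * R).degree := by
      rw [← natDegree_pos_iff_degree_pos, natDegree_mul (by simp) hR0, natDegree_X_pow]
      omega
    rw [degree_sub_eq_left_of_degree_lt (by simpa using h1)]
    exact h1.ne'
  obtain ⟨x, hx⟩ := IsAlgClosed.exists_root _ hdeg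
  have hx1 : x ^ (Q - 1) * R.eval x = 1 := by
    have : x ^ (Q - 1) * R.eval x - 1 = 0 := by simpa [IsRoot] using hx
    linear_combination this
  have hx0 : x ≠ 0 := by
    rintro rfl
    rw [zero_pow (by omega)] at hx1
    simp at hx1
  have hm : (P m).eval x = x := by
    rw [hR]
    simp only [eval_mul, eval_pow, eval_X]
    obtain ⟨n, rfl⟩ : ∃ n, Q = n + 1 := ⟨Q - 1, by omega⟩
    simp only [Nat.add_sub_cancel] at hx1
    linear_combination x * hx1
  refine ⟨fun i => (P i).eval x, ?_, ?_, ?_⟩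
  · simpa [hm] using hx0
  · simp [hm, hP0]
  · intro i
    simp [hm, hPs]

open Polynomial in
/-- Artin–Schreier equations are solvable over algebraically closed fields. -/
lemma exists_pow_sub_self_eq {k : Type*} [Field k] [IsAlgClosed k] {Q : ℕ} (hQ : 2 ≤ Q) (c : k) :
    ∃ t : k, t ^ Q - t = c := by
  have hdeg : (X ^ Q - X - C c : k[X]).degree ≠ 0 := by
    have h : (X + C c : k[X]).degree < (X ^ Q : k[X]).degree := by
      rw [degree_X_pow, degree_X_add_C]; exact_mod_cast hQ
    rw [sub_sub, degree_sub_eq_left_of_degree_lt h, degree_X_pow]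
    exact_mod_cast (by omega : Q ≠ 0)
  obtain ⟨t, ht⟩ := IsAlgClosed.exists_root _ hdeg
  refine ⟨t, ?_⟩
  have : t ^ Q - t - c = 0 := by simpa [IsRoot] using ht
  linear_combination this

/-- **Lang's theorem** for `GL_n`, in linear form: a subspace stable under an injective Frobenius
semilinear map is spanned by its fixed vectors. -/
theorem le_span_fixedPoints {k V : Type*} [Field k] [IsAlgClosed k] [AddCommGroup V] [Module k V]
    [FiniteDimensional k V] {Q : ℕ} (hQ : 2 ≤ Q) {σ : k →+* k} (hσ : ∀ x, σ x = x ^ Q)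
    (φ : V →ₛₗ[σ] V) (hφ : Function.Injective φ) (U : Submodule k V) (hU : ∀ u ∈ U, φ u ∈ U) :
    U ≤ Submodule.span k {u | u ∈ U ∧ φ u = u} := by
  set W := Submodule.span k {u | u ∈ U ∧ φ u = u} with hW
  have hWU : W ≤ U := Submodule.span_le.2 fun u hu => hu.1
  -- `φ` restricts to a bijection of `W`, and `φ - 1` is surjective on `W`
  have hsurj : ∀ w ∈ W, ∃ y ∈ W, φ y = w := by
    intro w hw
    induction hw using Submodule.span_induction with
    | mem x h => exact ⟨x, Submodule.subset_span h, h.2⟩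
    | zero => exact ⟨0, W.zero_mem, map_zero _⟩
    | add x y _ _ hx hy =>
      obtain ⟨x', hx', rfl⟩ := hx
      obtain ⟨y', hy', rfl⟩ := hy
      exact ⟨x' + y', W.add_mem hx' hy', map_add _ _ _⟩
    | smul a x _ hx =>
      obtain ⟨x', hx', rfl⟩ := hx
      obtain ⟨b, hb⟩ := IsAlgClosed.exists_pow_nat_eq a (n := Q) (by omega)
      exact ⟨b • x', W.smul_mem _ hx', by rw [map_smulₛₗ, hσ, hb]⟩
  have hAS : ∀ w ∈ W, ∃ y ∈ W, φ y - y = w := by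
    have hspan : ∀ w ∈ Submodule.span k {u | u ∈ U ∧ φ u = u}, ∀ c : k,
        ∃ y ∈ W, φ y - y = c • w := by
      intro w hw
      induction hw using Submodule.span_induction with
      | mem x h =>
        intro c
        obtain ⟨t, ht⟩ := exists_pow_sub_self_eq hQ c
        refine ⟨t • x, W.smul_mem _ (Submodule.subset_span h), ?_⟩
        rw [map_smulₛₗ, hσ, h.2, ← sub_smul, ht]
      | zero => intro c; exact ⟨0, W.zero_mem, by simp⟩
      | add x y _ _ hx hy =>
        intro c
        obtain ⟨x', hx', hx⟩ := hx c
        obtain ⟨y', hy', hy⟩ := hy c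
        refine ⟨x' + y', W.add_mem hx' hy', ?_⟩
        rw [map_add, smul_add, ← hx, ← hy]; abel
      | smul a x _ hx =>
        intro c
        rw [smul_smul]
        exact hx _
    intro w hw
    simpa using hspan w hw 1
  have hmemW : ∀ x, φ x ∈ W → x ∈ W := by
    intro x hx
    obtain ⟨y, hy, hxy⟩ := hsurj _ hx
    rwa [← hφ hxy]
  by_contra hcon
  obtain ⟨v, hvU, hvW⟩ := Set.not_subset.1 hcon
  have hiterW : ∀ n, φ^[n] v ∉ W := by
    intro n
    induction n with
    | zero => exact hvW
    | succ n ih =>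
      rw [Function.iterate_succ_apply']
      exact fun h => ih (hmemW _ h)
  have hiterU : ∀ n, φ^[n] v ∈ U := by
    intro n
    induction n with
    | zero => exact hvU
    | succ n ih =>
      rw [Function.iterate_succ_apply']
      exact hU _ ih
  let S : ℕ →o Submodule k V :=
    ⟨fun n => W ⊔ Submodule.span k ((fun i => φ^[i] v) '' (Finset.range n : Set ℕ)), by
      intro a b hab
      exact sup_le_sup_left (Submodule.span_mono
        (Set.image_mono (by simpa using hab))) _⟩
  have hS : ∀ n x, x ∈ S n ↔ ∃ c : ℕ → k, ∃ u ∈ W,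
      x = u + ∑ i ∈ Finset.range n, c i • φ^[i] v := by
    intro n x
    change x ∈ W ⊔ Submodule.span k ((fun i => φ^[i] v) '' (Finset.range n : Set ℕ)) ↔ _
    rw [Submodule.mem_sup]
    constructor
    · rintro ⟨u, hu, z, hz, rfl⟩
      rw [Submodule.mem_span_image_finset_iff_exists_fun] at hz
      obtain ⟨c, rfl⟩ := hz
      refine ⟨fun i => if h : i ∈ Finset.range n then c ⟨i, h⟩ else 0, u, hu, ?_⟩
      rw [← Finset.sum_coe_sort (Finset.range n)]
      simp only [Finset.coe_mem, dif_pos]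
    · rintro ⟨c, u, hu, rfl⟩
      exact ⟨u, hu, _, (Submodule.mem_span_image_finset_iff_exists_fun k).2
        ⟨fun i => c i, Finset.sum_coe_sort _ fun i => c i • φ^[i] v⟩, rfl⟩
  have hex : ∃ n, φ^[n] v ∈ S n := by
    obtain ⟨n, hn⟩ := monotone_stabilizes_iff_noetherian.2 (inferInstance : IsNoetherian k V) S
    refine ⟨n, ?_⟩
    rw [hn (n + 1) (by omega), hS]
    exact ⟨fun i => if i = n then 1 else 0, 0, W.zero_mem, by simp⟩
  classical
  obtain ⟨N, hN, hmin⟩ : ∃ n, φ^[n] v ∈ S n ∧ ∀ m < n, φ^[m] v ∉ S m :=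
    ⟨Nat.find hex, Nat.find_spec hex, fun m hm => Nat.find_min hex hm⟩
  obtain ⟨a, u, hu, hau⟩ := (hS _ _).1 hN
  obtain ⟨m, rfl⟩ : ∃ m, N = m + 1 := by
    cases N with
    | zero => exact absurd (by simpa [hau] using hu) (hiterW 0)
    | succ m => exact ⟨m, rfl⟩
  have ha : ∃ i ≤ m, a i ≠ 0 := by
    by_contra! h
    apply hiterW (m + 1)
    rw [hau, Finset.sum_eq_zero, add_zero]
    · exact hu
    · intro i hi
      rw [h i (by simpa [Nat.lt_succ_iff] using hi), zero_smul]
  obtain ⟨ξ, hξ, hξ0, hξs⟩ := exists_frobenius_recursion hQ a m ha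
  set w := ∑ i ∈ Finset.range (m + 1), ξ i • φ^[i] v with hw
  have hφw : φ w = w + ξ m ^ Q • u := by
    have h1 : φ w = (∑ i ∈ Finset.range m, ξ i ^ Q • φ^[i + 1] v) + ξ m ^ Q • φ^[m + 1] v := by
      rw [hw, map_sum, Finset.sum_range_succ]
      simp only [map_smulₛₗ, hσ, Function.iterate_succ_apply']
    have h2 : w = (∑ i ∈ Finset.range m, ξ i ^ Q • φ^[i + 1] v) +
        ξ m ^ Q • ∑ i ∈ Finset.range (m + 1), a i • φ^[i] v := by
      rw [hw, Finset.sum_range_succ', Finset.sum_range_succ' (fun i => a i • φ^[i] v), hξ0,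
        smul_add, ← add_assoc, Finset.smul_sum, ← Finset.sum_add_distrib, smul_smul, mul_comm]
      congr 1
      refine Finset.sum_congr rfl fun i _ => ?_
      rw [hξs, add_smul, smul_smul, mul_comm]
    rw [h1, hau, smul_add, h2]; abel
  have hwU : w ∈ U := U.sum_mem fun i _ => U.smul_mem _ (hiterU i)
  have hwW : w ∉ W := by
    intro h
    apply hmin m (by omega)
    have h3 : φ^[m] v = (ξ m)⁻¹ • (w - ∑ i ∈ Finset.range m, ξ i • φ^[i] v) := by
      rw [hw, Finset.sum_range_succ, add_sub_cancel_left, smul_smul, inv_mul_cancel₀ hξ, one_smul]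
    rw [hS]
    refine ⟨fun i => -((ξ m)⁻¹ * ξ i), (ξ m)⁻¹ • w, W.smul_mem _ h, ?_⟩
    rw [h3, smul_sub, sub_eq_add_neg, Finset.smul_sum (s := Finset.range m)]
    simp only [neg_smul, smul_smul, Finset.sum_neg_distrib]
  obtain ⟨y, hy, hyu⟩ := hAS (-(ξ m ^ Q • u)) (W.neg_mem (W.smul_mem _ hu))
  apply hwW
  have hfix : w + y ∈ W := by
    refine Submodule.subset_span ⟨U.add_mem hwU (hWU hy), ?_⟩
    rw [map_add, hφw, ← sub_eq_zero]
    rw [← sub_eq_zero] at hyu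
    rw [← hyu]; abel
  simpa using W.sub_mem hfix hy

open Polynomial in
/-- The equation `x ^ m = c * x` has `m` solutions when `m` vanishes in `k`. -/
lemma card_pow_eq_mul_self {k : Type*} [Field k] [IsAlgClosed k] {m : ℕ} (hm : 2 ≤ m)
    (hmk : (m : k) = 0) {c : k} (hc : c ≠ 0) : Nat.card {x : k // x ^ m = c * x} = m := by
  set f : k[X] := X ^ m - C c * X with hf
  have hlt : (C c * X : k[X]).natDegree < (X ^ m : k[X]).natDegree := by
    rw [natDegree_C_mul_X _ hc, natDegree_X_pow]; omega
  have hdeg : f.natDegree = m := by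
    rw [hf, natDegree_sub_eq_left_of_natDegree_lt hlt, natDegree_X_pow]
  have hf0 : f ≠ 0 := by
    intro h
    rw [h, natDegree_zero] at hdeg; omega
  have hsep : f.Separable := by
    rw [separable_def]
    have : derivative f = C (-c) := by
      rw [hf, derivative_sub, derivative_X_pow, hmk]
      simp
    rw [this]
    exact isCoprime_one_right.of_isCoprime_of_dvd_right
      (isUnit_iff_dvd_one.1 (isUnit_C.2 (neg_ne_zero.2 hc).isUnit))
  have hcard := card_rootSet_eq_natDegree (K := k) hsep (IsAlgClosed.splits _)
  rw [hdeg, ← Nat.card_eq_fintype_card] at hcard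
  refine (Nat.card_congr (Equiv.subtypeEquivRight fun x => ?_)).trans hcard
  rw [mem_rootSet]
  rw [and_iff_right hf0, hf]
  simp [sub_eq_zero]

section Orthonormal

variable {k V : Type*} [Field k] [IsAlgClosed k] [AddCommGroup V] [Module k V]
  {q : ℕ} {τ σ : k →+* k}

/-- If a sesquilinear form is Hermitian with respect to `φ`, then it has an anisotropic fixed
vector in any subspace spanned by fixed vectors on which it does not vanish. -/
lemma exists_fixed_anisotropic (hq : 2 ≤ q) (hqk : (q : k) = 0) (hτ : ∀ x, τ x = x ^ q)
    (hσ : ∀ x, σ x = x ^ (q * q)) (B : V →ₛₗ[τ] V →ₗ[k] k) {φ : V →ₛₗ[σ] V}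
    (hadj : ∀ v w, B v w ^ q = B w (φ v))
    (W : Submodule k V) (hW : W ≤ Submodule.span k {u | u ∈ W ∧ φ u = u})
    (hne : ∃ x ∈ W, ∃ y ∈ W, B x y ≠ 0) : ∃ v ∈ W, φ v = v ∧ B v v ≠ 0 := by
  have hpair : ∃ x y, (x ∈ W ∧ φ x = x) ∧ (y ∈ W ∧ φ y = y) ∧ B x y ≠ 0 := by
    by_contra! h
    obtain ⟨x, hx, y, hy, hxy⟩ := hne
    apply hxy
    have h1 : ∀ x, (x ∈ W ∧ φ x = x) → B x y = 0 := fun x hx =>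
      (Submodule.span_le (p := LinearMap.ker (B x))).2 (fun z hz => h x z hx hz) (hW hy)
    exact (Submodule.span_le (p := LinearMap.ker (B.flip y))).2 (fun z hz => h1 z hz) (hW hx)
  obtain ⟨x, y, ⟨hx, hφx⟩, ⟨hy, hφy⟩, hxy⟩ := hpair
  by_contra! h
  have hsym : ∀ {v w}, φ v = v → B v w ^ q = B w v := fun {v w} hv => by rw [hadj, hv]
  set s := B x y with hs
  have hyx : B y x = s ^ q := (hsym hφx).symm
  have hsq : s ^ (q * q) = s := by rw [pow_mul, ← hyx, hsym hφy]
  have hfixsmul : ∀ c : k, c ^ (q * q) = c → φ (x + c • y) = x + c • y := by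
    intro c hc
    rw [map_add, map_smulₛₗ, hφx, hφy, hσ, hc]
  have key : ∀ d : k, d ^ (q * q) = 1 * d → d ^ q = (-1) * d := by
    intro d hd
    rw [one_mul] at hd
    have hc : (d / s) ^ (q * q) = d / s := by rw [div_pow, hd, hsq]
    have h0 := h (x + (d / s) • y) (W.add_mem hx (W.smul_mem _ hy)) (hfixsmul _ hc)
    have hxx := h x hx hφx
    have hyy := h y hy hφy
    simp only [map_add, map_smulₛₗ, LinearMap.add_apply, LinearMap.smul_apply, hτ, hxx, hyy,
      ← hs, hyx, smul_eq_mul, RingHom.id_apply, mul_zero, zero_add, add_zero, ← mul_pow,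
      div_mul_cancel₀ _ hxy] at h0
    linear_combination h0
  have hcard1 := card_pow_eq_mul_self (k := k) (m := q * q) (by nlinarith) (by simp [hqk])
    one_ne_zero
  have hcard2 := card_pow_eq_mul_self (k := k) hq hqk (c := -1) (by simp)
  have : Finite {x : k // x ^ q = -1 * x} := Nat.finite_of_card_ne_zero (by omega)
  have hle := Nat.card_le_card_of_injective (Subtype.impEmbedding _ _ key)
    (Subtype.impEmbedding _ _ key).injective
  rw [hcard1, hcard2] at hle
  nlinarith

/-- A nondegenerate sesquilinear form that is Hermitian with respect to an injective Frobenius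
semilinear map has orthonormal families of every length up to the dimension. -/
theorem exists_orthonormal [FiniteDimensional k V] (hq : 2 ≤ q) (hqk : (q : k) = 0)
    (hτ : ∀ x, τ x = x ^ q) (hσ : ∀ x, σ x = x ^ (q * q)) (B : V →ₛₗ[τ] V →ₗ[k] k)
    {φ : V →ₛₗ[σ] V} (hφ : Function.Injective φ) (hadj : ∀ v w, B v w ^ q = B w (φ v))
    (hnd : ∀ w, (∀ v, B v w = 0) → w = 0) (m : ℕ) (hm : m ≤ Module.finrank k V) :
    ∃ e : Fin m → V, (∀ i, φ (e i) = e i) ∧ ∀ i j, B (e i) (e j) = if i = j then 1 else 0 := by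
  have hsym : ∀ {v w}, φ v = v → B v w ^ q = B w v := fun {v w} hv => by rw [hadj, hv]
  have hq0 : q ≠ 0 := by omega
  induction m with
  | zero => exact ⟨Fin.elim0, fun i => i.elim0, fun i => i.elim0⟩
  | succ m ih =>
    obtain ⟨e, hfix, hon⟩ := ih (by omega)
    set W : Submodule k V := LinearMap.ker (LinearMap.pi fun i => B (e i)) with hWdef
    have hW : ∀ w, w ∈ W ↔ ∀ i, B (e i) w = 0 := fun w => by simp [hWdef, funext_iff]
    have hW' : ∀ w ∈ W, ∀ i, B w (e i) = 0 := fun w hw i => by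
      rw [← hsym (hfix i), (hW w).1 hw i, zero_pow hq0]
    have hφW : ∀ w ∈ W, φ w ∈ W := fun w hw => (hW _).2 fun i => by
      rw [← hadj, hW' w hw, zero_pow hq0]
    have hWbot : W ≠ ⊥ := LinearMap.ker_ne_bot_of_finrank_lt (by simpa using hm)
    obtain ⟨w, hw, hw0⟩ := W.ne_bot_iff.1 hWbot
    have hne : ∃ x ∈ W, ∃ y ∈ W, B x y ≠ 0 := by
      by_contra! h
      refine hw0 (hnd w fun v => ?_)
      -- subtract from `v` its projection to the span of `e`
      obtain ⟨c, hc⟩ : ∃ c : Fin m → k, v - ∑ i, c i • e i ∈ W := by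
        refine ⟨fun i => B (e i) v, (hW _).2 fun j => ?_⟩
        simp [hon]
      have h1 := h _ hc w hw
      simpa [(hW w).1 hw] using h1
    obtain ⟨v, hvW, hv, hvv⟩ := exists_fixed_anisotropic hq hqk hτ hσ B hadj W
      (le_span_fixedPoints (by nlinarith) hσ φ hφ W hφW) hne
    obtain ⟨t, ht⟩ := IsAlgClosed.exists_pow_nat_eq (B v v)⁻¹ (n := q + 1) (by omega)
    have ht0 : t ≠ 0 := by
      rintro rfl
      rw [zero_pow (by omega)] at ht
      exact inv_ne_zero hvv ht.symm
    have htfix : t ^ (q * q) = t := by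
      have h1 : (t ^ (q + 1)) ^ q = t ^ (q + 1) := by rw [ht, inv_pow, hsym hv]
      refine mul_right_cancel₀ (pow_ne_zero q ht0) ?_
      calc t ^ (q * q) * t ^ q = (t ^ (q + 1)) ^ q := by ring
        _ = t * t ^ q := by rw [h1]; ring
    refine ⟨Fin.cons (t • v) e, ?_, ?_⟩
    · rw [Fin.forall_fin_succ]
      exact ⟨by simp [hσ, htfix, hv], by simpa using hfix⟩
    · have hvv' : t ^ q * (t * B v v) = 1 := by
        rw [← mul_assoc, ← pow_succ, ht, inv_mul_cancel₀ hvv]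
      simp only [Fin.forall_fin_succ, Fin.cons_zero, Fin.cons_succ]
      refine ⟨⟨by simpa [hτ, mul_left_comm] using hvv', fun i => ?_⟩, fun i => ⟨?_, fun j => ?_⟩⟩
      · simp [hW' v hvW, (Fin.succ_ne_zero i).symm]
      · simp [(hW v).1 hvW]
      · simp [hon]

end Orthonormal

section Matrix

open Matrix

variable {k : Type*} [Field k] [IsAlgClosed k] {q n : ℕ}

/-- Every `q`-bic form with invertible Gram matrix becomes the Fermat form `∑ i, x i ^ q * y i`
after a linear change of coordinates. -/
theorem exists_linearEquiv_fermat (hq : 2 ≤ q) (hqk : (q : k) = 0) {τ : k →+* k}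
    (hτ : ∀ x, τ x = x ^ q) (A : Matrix (Fin n) (Fin n) k) (hA : IsUnit A.det) :
    ∃ P : (Fin n → k) ≃ₗ[k] (Fin n → k), ∀ x y,
      (∑ i, ∑ j, A i j * (P x i) ^ q * P y j) = ∑ i, x i ^ q * y i := by
  set B : (Fin n → k) →ₛₗ[τ] (Fin n → k) →ₗ[k] k :=
    LinearMap.mk₂'ₛₗ τ (RingHom.id k) (fun v w => (τ ∘ v) ⬝ᵥ (A *ᵥ w))
      (fun v v' w => by
        rw [← add_dotProduct]; congr 1; ext; simp)
      (fun c v w => by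
        rw [← smul_dotProduct]; congr 1; ext; simp)
      (fun v w w' => by rw [mulVec_add, dotProduct_add])
      (fun c v w => by rw [mulVec_smul, dotProduct_smul]; rfl) with hBdef
  have hB : ∀ v w, B v w = (τ ∘ v) ⬝ᵥ (A *ᵥ w) := fun v w => rfl
  have hB' : ∀ v w, B v w = ∑ i, ∑ j, A i j * v i ^ q * w j := fun v w => by
    simp only [hB, dotProduct, mulVec, Finset.mul_sum, Function.comp_apply, hτ]
    exact Finset.sum_congr rfl fun i _ => Finset.sum_congr rfl fun j _ => by ring
  let φ : (Fin n → k) →ₛₗ[τ.comp τ] (Fin n → k) :=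
    { toFun := fun v => A⁻¹ *ᵥ ((A.map τ)ᵀ *ᵥ (τ ∘ τ ∘ v))
      map_add' := fun v w => by
        rw [← mulVec_add, ← mulVec_add]; congr 2; ext; simp
      map_smul' := fun c v => by
        rw [← mulVec_smul, ← mulVec_smul]; congr 2; ext; simp }
  have hφdef : ∀ v, φ v = A⁻¹ *ᵥ ((A.map τ)ᵀ *ᵥ (τ ∘ τ ∘ v)) := fun v => rfl
  have hdet : IsUnit (A.map τ)ᵀ.det := by
    rw [det_transpose]
    have : (A.map τ).det = τ A.det := (RingHom.map_det τ A).symm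
    rw [this]
    exact hA.map τ
  have hAunit : IsUnit A := (isUnit_iff_isUnit_det A).2 hA
  have hφ : Function.Injective φ := by
    intro v w h
    rw [hφdef, hφdef] at h
    have h1 := mulVec_injective_of_isUnit ((isUnit_nonsing_inv_iff).2 hAunit) h
    have h2 := mulVec_injective_of_isUnit ((isUnit_iff_isUnit_det _).2 hdet) h1
    ext i
    exact τ.injective (τ.injective (congrFun h2 i))
  have hadj : ∀ v w, B v w ^ q = B w (φ v) := fun v w => by
    rw [← hτ, hB, hB, hφdef, mulVec_mulVec, mul_nonsing_inv A hA, one_mulVec, mulVec_transpose,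
      dotProduct_comm (τ ∘ w), ← dotProduct_mulVec, RingHom.map_dotProduct]
    congr 1
    ext i
    exact RingHom.map_mulVec τ A w i
  have hnd : ∀ w, (∀ v, B v w = 0) → w = 0 := by
    intro w h
    have h0 : A *ᵥ w = A *ᵥ 0 := by
      ext i
      have := h (Pi.single i 1)
      have hs : τ ∘ (Pi.single i (1 : k) : Fin n → k) = Pi.single i 1 := by
        ext j
        by_cases hj : j = i
        · subst hj; simp
        · simp [hj]
      rw [hB, hs, single_one_dotProduct] at this
      simpa using this
    exact mulVec_injective_of_isUnit hAunit h0
  obtain ⟨e, -, he⟩ := exists_orthonormal hq hqk hτ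
    (fun x => by rw [RingHom.comp_apply, hτ, hτ, ← pow_mul]) B hφ hadj hnd n (by simp)
  let P : (Fin n → k) →ₗ[k] (Fin n → k) := Fintype.linearCombination k e
  have hP : ∀ x, P x = ∑ i, x i • e i := fun x => rfl
  have hBP : ∀ x y, B (P x) (P y) = ∑ i, x i ^ q * y i := fun x y => by
    simp [hP, he, hτ, mul_comm]
  have hinj : Function.Injective P := by
    rw [← LinearMap.ker_eq_bot, LinearMap.ker_eq_bot']
    intro x hx
    ext i
    have := hBP (Pi.single i 1) x
    simpa [hx, Pi.single_apply, ite_pow, show q ≠ 0 by omega] using this.symm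
  refine ⟨LinearEquiv.ofInjectiveEndo P hinj, fun x y => ?_⟩
  rw [← hBP, hB']
  rfl

/-- Two `q`-bic forms with invertible Gram matrices differ by a linear change of coordinates. -/
theorem exists_linearEquiv_qbic (hq : 2 ≤ q) (hqk : (q : k) = 0) {τ : k →+* k}
    (hτ : ∀ x, τ x = x ^ q) (A J : Matrix (Fin n) (Fin n) k) (hA : IsUnit A.det)
    (hJ : IsUnit J.det) :
    ∃ P : (Fin n → k) ≃ₗ[k] (Fin n → k), ∀ x y,
      (∑ i, ∑ j, A i j * (P x i) ^ q * P y j) = ∑ i, ∑ j, J i j * x i ^ q * y j := by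
  obtain ⟨S, hS⟩ := exists_linearEquiv_fermat hq hqk hτ A hA
  obtain ⟨T, hT⟩ := exists_linearEquiv_fermat hq hqk hτ J hJ
  refine ⟨T.symm.trans S, fun x y => ?_⟩
  have h := hT (T.symm x) (T.symm y)
  simp only [LinearEquiv.apply_symm_apply] at h
  rw [h, ← hS]
  rfl

end Matrix

section Hyperbolic

variable {k : Type*} [Field k] {q : ℕ}

/-- The split `q`-bic form on `k⁴`. -/
def splitForm (q : ℕ) (x y : Fin 4 → k) : k :=
  x 0 ^ q * y 3 + x 1 ^ q * y 2 + x 2 ^ q * y 1 + x 3 ^ q * y 0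

/-- The two-dimensional isotropic subspaces of the split form, sorted by Schubert cell. -/
def splitLine (q : ℕ) :
    (({x : k // x ^ (q * q) = 1 * x} × {x : k // x ^ q = -1 * x} × {x : k // x ^ q = -1 * x}) ⊕
      ({x : k // x ^ (q * q) = 1 * x} × {x : k // x ^ q = -1 * x})) ⊕
      ({x : k // x ^ q = -1 * x} ⊕ Unit) → Submodule k (Fin 4 → k)
  | .inl (.inl (a, b, c)) => Submodule.span k {![1, 0, a.1, b.1], ![0, 1, c.1, -a.1 ^ q]}
  | .inl (.inr (a, b)) => Submodule.span k {![1, a.1, 0, b.1], ![0, 0, 1, -a.1 ^ q]}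
  | .inr (.inl a) => Submodule.span k {![0, 1, a.1, 0], ![0, 0, 0, 1]}
  | .inr (.inr _) => Submodule.span k {![0, 0, 1, 0], ![0, 0, 0, 1]}

lemma mem_cell_one {a b c d : k} {x : Fin 4 → k} :
    x ∈ Submodule.span k {![1, 0, a, b], ![0, 1, c, d]} ↔
      x 2 = a * x 0 + c * x 1 ∧ x 3 = b * x 0 + d * x 1 := by
  rw [Submodule.mem_span_pair]
  constructor
  · rintro ⟨s, t, rfl⟩
    simp [mul_comm]
  · rintro ⟨h2, h3⟩
    refine ⟨x 0, x 1, ?_⟩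
    ext i; fin_cases i <;> simp [h2, h3, mul_comm]

lemma mem_cell_two {a b c : k} {x : Fin 4 → k} :
    x ∈ Submodule.span k {![1, a, 0, b], ![0, 0, 1, c]} ↔
      x 1 = a * x 0 ∧ x 3 = b * x 0 + c * x 2 := by
  rw [Submodule.mem_span_pair]
  constructor
  · rintro ⟨s, t, rfl⟩
    simp [mul_comm]
  · rintro ⟨h2, h3⟩
    refine ⟨x 0, x 2, ?_⟩
    ext i; fin_cases i <;> simp [h2, h3, mul_comm]

lemma mem_cell_three {a : k} {x : Fin 4 → k} :
    x ∈ Submodule.span k {![0, 1, a, 0], ![0, 0, 0, 1]} ↔ x 0 = 0 ∧ x 2 = a * x 1 := by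
  rw [Submodule.mem_span_pair]
  constructor
  · rintro ⟨s, t, rfl⟩
    simp [mul_comm]
  · rintro ⟨h2, h3⟩
    refine ⟨x 1, x 3, ?_⟩
    ext i; fin_cases i <;> simp [h2, h3, mul_comm]

lemma mem_cell_four {x : Fin 4 → k} :
    x ∈ Submodule.span k {![0, 0, 1, 0], ![0, 0, 0, 1]} ↔ x 0 = 0 ∧ x 1 = 0 := by
  rw [Submodule.mem_span_pair]
  constructor
  · rintro ⟨s, t, rfl⟩
    simp
  · rintro ⟨h2, h3⟩
    refine ⟨x 2, x 3, ?_⟩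
    ext i; fin_cases i <;> simp [h2, h3]

lemma splitLine_injective : Function.Injective (splitLine (k := k) q) := by
  intro s t h
  have h' : ∀ x, x ∈ splitLine q s ↔ x ∈ splitLine q t := fun x => by rw [h]
  rcases s with (⟨⟨a, ha⟩, ⟨b, hb⟩, ⟨c, hc⟩⟩ | ⟨⟨a, ha⟩, ⟨b, hb⟩⟩) | (⟨a, ha⟩ | _) <;>
  rcases t with (⟨⟨a', ha'⟩, ⟨b', hb'⟩, ⟨c', hc'⟩⟩ | ⟨⟨a', ha'⟩, ⟨b', hb'⟩⟩) | (⟨a', ha'⟩ | _) <;>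
  simp only [splitLine, mem_cell_one, mem_cell_two, mem_cell_three, mem_cell_four] at h'
  · have h1 := h' ![1, 0, a, b]
    have h2 := h' ![0, 1, c, -a ^ q]
    simp at h1 h2
    simp [h1, h2]
  · have h2 := h' ![0, 1, c, -a ^ q]
    simp at h2
  · have h1 := h' ![1, 0, a, b]
    simp at h1
  · have h1 := h' ![1, 0, a, b]
    simp at h1
  · have h2 := h' ![0, 1, c', -a' ^ q]
    simp at h2
  · have h1 := h' ![1, a, 0, b]
    simp at h1
    simp [h1]
  · have h1 := h' ![1, a, 0, b]
    simp at h1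
  · have h1 := h' ![1, a, 0, b]
    simp at h1
  · have h1 := h' ![1, 0, a', b']
    simp at h1
  · have h1 := h' ![1, a', 0, b']
    simp at h1
  · have h1 := h' ![0, 1, a, 0]
    simp at h1
    simp [h1]
  · have h1 := h' ![0, 1, a, 0]
    simp at h1
  · have h1 := h' ![1, 0, a', b']
    simp at h1
  · have h1 := h' ![1, a', 0, b']
    simp at h1
  · have h1 := h' ![0, 1, a', 0]
    simp at h1
  · rfl

lemma finrank_span_pair_eq_two {V : Type*} [AddCommGroup V] [Module k V] {u v : V}
    (h : LinearIndependent k ![u, v]) : Module.finrank k (Submodule.span k {u, v}) = 2 := by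
  rw [← Matrix.range_cons_cons_empty u v ![], finrank_span_eq_card h, Fintype.card_fin]

lemma span_pair_eq_of_finrank_eq_two {V : Type*} [AddCommGroup V] [Module k V] {u v : V}
    (h : LinearIndependent k ![u, v]) {U : Submodule k V} (hU : Module.finrank k U = 2)
    (hu : u ∈ U) (hv : v ∈ U) : U = Submodule.span k {u, v} := by
  have : FiniteDimensional k U := Module.finite_of_finrank_pos (by omega)
  refine (Submodule.eq_of_le_of_finrank_eq (Submodule.span_le.2 ?_) ?_).symm
  · rintro x (rfl | rfl) <;> assumption
  · rw [hU, finrank_span_pair_eq_two h]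

lemma exists_mem_apply_eq_zero {ι : Type*} [Finite ι] {U : Submodule k (ι → k)}
    (hU : Module.finrank k U = 2) (i : ι) : ∃ v ∈ U, v ≠ 0 ∧ v i = 0 := by
  have h : LinearMap.ker ((LinearMap.proj i : (ι → k) →ₗ[k] k).domRestrict U) ≠ ⊥ :=
    LinearMap.ker_ne_bot_of_finrank_lt (by simp [hU])
  obtain ⟨v, hv, hv0⟩ := (Submodule.ne_bot_iff _).1 h
  exact ⟨v, v.2, by simpa using hv0, by simpa using hv⟩

/-- A subspace with a vector not vanishing at `i` has a vector taking the value `1` at `i`. -/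
lemma exists_mem_apply_eq_one {ι : Type*} {U : Submodule k (ι → k)} {u : ι → k} (hu : u ∈ U)
    {i : ι} (hi : u i ≠ 0) : ∃ v ∈ U, v i = 1 ∧ ∀ j, u j = 0 → v j = 0 :=
  ⟨(u i)⁻¹ • u, U.smul_mem _ hu, by simp [hi], fun j hj => by simp [hj]⟩

lemma linearIndependent_pair_of_pivots {ι : Type*} {u v : ι → k} {i j : ι} (hui : u i = 1)
    (hvi : v i = 0) (hvj : v j = 1) : LinearIndependent k ![u, v] := by
  rw [LinearIndependent.pair_iff]
  intro s t h
  have hs : s = 0 := by simpa [hui, hvi] using congrFun h i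
  subst hs
  exact ⟨rfl, by simpa [hvj] using congrFun h j⟩

lemma splitForm_eq_zero_of_mem_span {τ : k →+* k} (hτ : ∀ x, τ x = x ^ q) {u v : Fin 4 → k}
    (huu : splitForm q u u = 0) (huv : splitForm q u v = 0) (hvu : splitForm q v u = 0)
    (hvv : splitForm q v v = 0) :
    ∀ x ∈ Submodule.span k {u, v}, ∀ y ∈ Submodule.span k {u, v}, splitForm q x y = 0 := by
  intro x hx y hy
  obtain ⟨s, t, rfl⟩ := Submodule.mem_span_pair.1 hx
  obtain ⟨s', t', rfl⟩ := Submodule.mem_span_pair.1 hy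
  simp only [splitForm, ← hτ, Pi.add_apply, Pi.smul_apply, smul_eq_mul, map_add, map_mul]
    at huu huv hvu hvv ⊢
  linear_combination τ s * s' * huu + τ s * t' * huv + τ t * s' * hvu + τ t * t' * hvv

lemma splitLine_isotropic (hq : 2 ≤ q) {τ : k →+* k} (hτ : ∀ x, τ x = x ^ q) (s) :
    Module.finrank k (splitLine (k := k) q s) = 2 ∧
      ∀ u ∈ splitLine q s, ∀ v ∈ splitLine q s, splitForm q u v = 0 := by
  have hq0 : q ≠ 0 := by omega
  have hneg : ∀ a : k, (-a) ^ q = -a ^ q := fun a => by rw [← hτ, map_neg, hτ]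
  rcases s with (⟨⟨a, ha⟩, ⟨b, hb⟩, ⟨c, hc⟩⟩ | ⟨⟨a, ha⟩, ⟨b, hb⟩⟩) | (⟨a, ha⟩ | _)
  · refine ⟨finrank_span_pair_eq_two
      (linearIndependent_pair_of_pivots (i := 0) (j := 1) rfl rfl rfl),
      splitForm_eq_zero_of_mem_span hτ ?_ ?_ ?_ ?_⟩ <;>
    simp [splitForm, hq0, hneg, ← pow_mul, ha, hb, hc]
  · refine ⟨finrank_span_pair_eq_two
      (linearIndependent_pair_of_pivots (i := 0) (j := 2) rfl rfl rfl),
      splitForm_eq_zero_of_mem_span hτ ?_ ?_ ?_ ?_⟩ <;>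
    simp [splitForm, hq0, hneg, ← pow_mul, ha, hb]
  · refine ⟨finrank_span_pair_eq_two
      (linearIndependent_pair_of_pivots (i := 1) (j := 3) rfl rfl rfl),
      splitForm_eq_zero_of_mem_span hτ ?_ ?_ ?_ ?_⟩ <;>
    simp [splitForm, hq0, ha]
  · refine ⟨finrank_span_pair_eq_two
      (linearIndependent_pair_of_pivots (i := 2) (j := 3) rfl rfl rfl),
      splitForm_eq_zero_of_mem_span hτ ?_ ?_ ?_ ?_⟩ <;>
    simp [splitForm, hq0]

lemma vec_four_eq {k : Type*} {x : Fin 4 → k} {a b c d : k} (h0 : x 0 = a) (h1 : x 1 = b)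
    (h2 : x 2 = c) (h3 : x 3 = d) : ![a, b, c, d] = x := by
  ext i; fin_cases i <;> simp [h0, h1, h2, h3]

lemma exists_splitLine_eq (hq : 2 ≤ q) {τ : k →+* k} (hτ : ∀ x, τ x = x ^ q)
    {U : Submodule k (Fin 4 → k)} (hU : Module.finrank k U = 2)
    (hiso : ∀ u ∈ U, ∀ v ∈ U, splitForm q u v = 0) : ∃ s, splitLine q s = U := by
  have hq0 : q ≠ 0 := by omega
  have hneg : ∀ a : k, (-a) ^ q = -a ^ q := fun a => by rw [← hτ, map_neg, hτ]
  by_cases h0 : ∃ u ∈ U, u 0 ≠ 0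
  · obtain ⟨u, hu, hu0⟩ := h0
    obtain ⟨u, hu, hu0, -⟩ := exists_mem_apply_eq_one hu hu0
    obtain ⟨v, hv, hvne, hv0⟩ := exists_mem_apply_eq_zero hU 0
    by_cases hv1 : v 1 = 0
    · have hv2 : v 2 ≠ 0 := by
        intro hv2
        have huv := hiso u hu v hv
        simp [splitForm, hu0, hv0, hv1, hv2] at huv
        exact hvne (funext fun i => by fin_cases i <;> assumption)
      obtain ⟨w, hw, hw2, hwz⟩ := exists_mem_apply_eq_one hv hv2
      have hw0 := hwz 0 hv0
      have hw1 := hwz 1 hv1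
      obtain ⟨r, hr, hr0, hr2⟩ : ∃ r ∈ U, r 0 = 1 ∧ r 2 = 0 :=
        ⟨u - u 2 • w, U.sub_mem hu (U.smul_mem _ hw), by simp [hu0, hw0], by simp [hw2]⟩
      have hrr := hiso r hr r hr
      have hrw := hiso r hr w hw
      have hwr := hiso w hw r hr
      simp [splitForm, hr0, hr2, hw0, hw1, hw2, hq0] at hrr hrw hwr
      have hw3 : w 3 = -r 1 ^ q := by linear_combination hrw
      rw [hw3, hneg, ← pow_mul] at hwr
      have hli : LinearIndependent k ![r, w] :=
        linearIndependent_pair_of_pivots (i := (0 : Fin 4)) (j := (2 : Fin 4)) hr0 hw0 hw2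
      rw [span_pair_eq_of_finrank_eq_two hli hU hr hw]
      exact ⟨.inl (.inr (⟨r 1, by linear_combination -hwr⟩, ⟨r 3, by linear_combination hrr⟩)),
        congrArg₂ (fun x y => Submodule.span k {x, y}) (vec_four_eq hr0 rfl hr2 rfl)
          (vec_four_eq hw0 hw1 hw2 hw3)⟩
    · obtain ⟨w, hw, hw1, hwz⟩ := exists_mem_apply_eq_one hv hv1
      have hw0 := hwz 0 hv0
      obtain ⟨r, hr, hr0, hr1⟩ : ∃ r ∈ U, r 0 = 1 ∧ r 1 = 0 :=
        ⟨u - u 1 • w, U.sub_mem hu (U.smul_mem _ hw), by simp [hu0, hw0], by simp [hw1]⟩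
      have hrr := hiso r hr r hr
      have hrw := hiso r hr w hw
      have hwr := hiso w hw r hr
      have hww := hiso w hw w hw
      simp [splitForm, hr0, hr1, hw0, hw1, hq0] at hrr hrw hwr hww
      have hw3 : w 3 = -r 2 ^ q := by linear_combination hrw
      rw [hw3, hneg, ← pow_mul] at hwr
      have hli : LinearIndependent k ![r, w] :=
        linearIndependent_pair_of_pivots (i := (0 : Fin 4)) (j := (1 : Fin 4)) hr0 hw0 hw1
      rw [span_pair_eq_of_finrank_eq_two hli hU hr hw]
      exact ⟨.inl (.inl (⟨r 2, by linear_combination -hwr⟩, ⟨r 3, by linear_combination hrr⟩,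
        ⟨w 2, by linear_combination hww⟩)),
        congrArg₂ (fun x y => Submodule.span k {x, y}) (vec_four_eq hr0 hr1 rfl rfl)
          (vec_four_eq hw0 hw1 rfl hw3)⟩
  · push Not at h0
    by_cases h1 : ∃ u ∈ U, u 1 ≠ 0
    · obtain ⟨u, hu, hu1⟩ := h1
      obtain ⟨u, hu, hu1, -⟩ := exists_mem_apply_eq_one hu hu1
      obtain ⟨v, hv, hvne, hv1⟩ := exists_mem_apply_eq_zero hU 1
      have huv := hiso u hu v hv
      simp [splitForm, hu1, hv1, h0 u hu, h0 v hv, hq0] at huv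
      have hv3 : v 3 ≠ 0 := by
        intro hv3
        have hv0 := h0 v hv
        exact hvne (funext fun i => by fin_cases i <;> assumption)
      obtain ⟨w, hw, hw3, hwz⟩ := exists_mem_apply_eq_one hv hv3
      have hw0 := h0 w hw
      have hw1 := hwz 1 hv1
      have hw2 := hwz 2 huv
      obtain ⟨r, hr, hr1, hr3⟩ : ∃ r ∈ U, r 1 = 1 ∧ r 3 = 0 :=
        ⟨u - u 3 • w, U.sub_mem hu (U.smul_mem _ hw), by simp [hu1, hw1], by simp [hw3]⟩
      have hr0 := h0 r hr
      have hrr := hiso r hr r hr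
      simp [splitForm, hr0, hr1, hr3, hq0] at hrr
      have hli : LinearIndependent k ![r, w] :=
        linearIndependent_pair_of_pivots (i := (1 : Fin 4)) (j := (3 : Fin 4)) hr1 hw1 hw3
      rw [span_pair_eq_of_finrank_eq_two hli hU hr hw]
      exact ⟨.inr (.inl ⟨r 2, by linear_combination hrr⟩),
        congrArg₂ (fun x y => Submodule.span k {x, y}) (vec_four_eq hr0 hr1 rfl hr3)
          (vec_four_eq hw0 hw1 hw2 hw3)⟩
    · push Not at h1
      refine ⟨.inr (.inr ()), (Submodule.eq_of_le_of_finrank_eq ?_ ?_).symm⟩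
      · exact fun x hx => mem_cell_four.2 ⟨h0 x hx, h1 x hx⟩
      · rw [hU, (splitLine_isotropic hq hτ _).1]

theorem card_isotropic_splitForm [IsAlgClosed k] (hq : 2 ≤ q) (hqk : (q : k) = 0) {τ : k →+* k}
    (hτ : ∀ x, τ x = x ^ q) :
    Nat.card {U : Submodule k (Fin 4 → k) // Module.finrank k U = 2 ∧
        ∀ u ∈ U, ∀ v ∈ U, splitForm q u v = 0} = (q + 1) * (q ^ 3 + 1) := by
  have hY := card_pow_eq_mul_self (k := k) (m := q * q) (by nlinarith) (by simp [hqk])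
    one_ne_zero
  have hZ := card_pow_eq_mul_self (k := k) hq hqk (c := -1) (by simp)
  have : Finite {x : k // x ^ (q * q) = 1 * x} :=
    Nat.finite_of_card_ne_zero (by rw [hY]; positivity)
  have : Finite {x : k // x ^ q = -1 * x} := Nat.finite_of_card_ne_zero (by omega)
  rw [← Nat.card_congr (Equiv.ofBijective (fun s => ⟨splitLine q s, splitLine_isotropic hq hτ s⟩)
    ⟨fun s t h => splitLine_injective (congrArg Subtype.val h), fun U => ?_⟩)]
  · simp only [Nat.card_sum, Nat.card_prod, hY, hZ, Nat.card_unique]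
    ring
  · obtain ⟨s, hs⟩ := exists_splitLine_eq hq hτ U.2.1 U.2.2
    exact ⟨s, Subtype.ext hs⟩

end Hyperbolic

/-- a smooth q-bic surface in P³ over an algebraically closed field of
characteristic p (q a power of p) contains exactly (q+1)(q³+1) lines, i.e. there are exactly
(q+1)(q³+1) two-dimensional subspaces of k⁴ on which the q-bic form (with invertible Gram
matrix) vanishes identically. -/
theorem stmt_6 {p q ν : ℕ} [Fact p.Prime] (hν : 0 < ν) (hq : q = p ^ ν)
    {k : Type*} [Field k] [IsAlgClosed k] [CharP k p]
    (A : Matrix (Fin 4) (Fin 4) k) (hA : IsUnit A.det)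
    (β : (Fin 4 → k) → (Fin 4 → k) → k)
    (hβ : ∀ v w : Fin 4 → k, β v w = ∑ i, ∑ j, A i j * (v i) ^ q * w j) :
    Nat.card {U : Submodule k (Fin 4 → k) // Module.finrank k U = 2 ∧
        ∀ u ∈ U, ∀ v ∈ U, β u v = 0}
      = (q + 1) * (q ^ 3 + 1) := by
  have hq2 : 2 ≤ q := hq ▸ (Fact.out : p.Prime).two_le.trans (Nat.le_self_pow hν.ne' p)
  have hqk : (q : k) = 0 := by simp [hq, hν.ne']
  have : ExpChar k p := ExpChar.prime Fact.out
  have hτ : ∀ x, iterateFrobenius k p ν x = x ^ q := fun x => by rw [iterateFrobenius_def, hq]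
  let J : Matrix (Fin 4) (Fin 4) k := !![0, 0, 0, 1; 0, 0, 1, 0; 0, 1, 0, 0; 1, 0, 0, 0]
  have hJ : IsUnit J.det := by
    have hJJ : J * J = 1 := by
      ext i j
      fin_cases i <;> fin_cases j <;> simp [J, Matrix.mul_apply, Fin.sum_univ_four]
    exact (Matrix.isUnit_iff_isUnit_det J).1 (IsUnit.of_mul_eq_one J hJJ)
  obtain ⟨P, hP⟩ := exists_linearEquiv_qbic hq2 hqk hτ A J hA hJ
  have hPβ : ∀ x y, β (P x) (P y) = splitForm q x y := fun x y => by
    rw [hβ, hP]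
    simp [J, Fin.sum_univ_four, splitForm]
  rw [← card_isotropic_splitForm (k := k) hq2 hqk hτ]
  refine (Nat.card_congr ((Submodule.orderIsoMapComap P).toEquiv.subtypeEquiv fun U => ?_)).symm
  refine and_congr ?_ ?_
  · exact (LinearEquiv.finrank_map_eq P U).symm ▸ Iff.rfl
  · have hU : ∀ x, x ∈ Submodule.map (P : (Fin 4 → k) →ₗ[k] (Fin 4 → k)) U ↔
        ∃ u ∈ U, P u = x := fun x => Submodule.mem_map
    change _ ↔ ∀ x ∈ Submodule.map (P : (Fin 4 → k) →ₗ[k] (Fin 4 → k)) U,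
      ∀ y ∈ Submodule.map (P : (Fin 4 → k) →ₗ[k] (Fin 4 → k)) U, β x y = 0
    simp only [hU, forall_exists_index, and_imp, forall_apply_eq_imp_iff₂, hPβ]
end

section
/- Poincaré duality identity for the Betti numbers of the Fano scheme: for 0 ≤ k ≤ 2m+2, define b_k := q̄^{C(2m+3-k,2)}·binom_{q̄}(2m+2,k) + Σ_{i=0}^{m-⌈k/2⌉} (1-q̄)^{i+1}·q̄^{C(2m+1-2i-k,2)}·[2i+1]_{q̄}!!·binom_{q̄}(2m+3,2i+2)·binom_{q̄}(2m-2i,k), with q̄ = -q. Then b_k = b_{2m+2-k} for all 0 ≤ k ≤ 2m+2; in particular b_1 = b_{2m+1} = q̄·[2m+2]_{q̄}. -/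
/-- Gaussian integer `[m]_t = (1 - t^m)/(1 - t)`. -/
def gInt (t : ℚ) (m : ℕ) : ℚ := (1 - t ^ m) / (1 - t)

/-- Gaussian factorial `[m]_t!`. -/
def gFact (t : ℚ) (m : ℕ) : ℚ := ∏ i ∈ Finset.range m, gInt t (i + 1)

/-- Gaussian binomial coefficient with parameter t. -/
def gBinom (t : ℚ) (n k : ℕ) : ℚ := gFact t n / (gFact t k * gFact t (n - k))

/-- Gaussian odd double factorial `[2k+1]_t!! = ∏_{i=0}^k [2i+1]_t`. -/
def gDFac (t : ℚ) (k : ℕ) : ℚ := ∏ i ∈ Finset.range (k + 1), gInt t (2 * i + 1)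

/-- The k-th Betti number of the Fano scheme of m-planes in a smooth q-bic hypersurface of
dimension 2m+1, as given by the Deligne–Lusztig computation, with q̄ = -q:
`b_k = q̄^{C(2m+3-k,2)} binom(2m+2,k) + Σ_{i=0}^{m-⌈k/2⌉} (1-q̄)^{i+1} q̄^{C(2m+1-2i-k,2)}
  [2i+1]!! binom(2m+3,2i+2) binom(2m-2i,k)`. -/
def fanoBetti (q m k : ℕ) : ℚ :=
  (-(q : ℚ)) ^ (Nat.choose (2 * m + 3 - k) 2) * gBinom (-(q : ℚ)) (2 * m + 2) k +
    ∑ i ∈ Finset.range (m + 1 - (k + 1) / 2),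
      (1 - (-(q : ℚ))) ^ (i + 1) * (-(q : ℚ)) ^ (Nat.choose (2 * m + 1 - 2 * i - k) 2)
        * gDFac (-(q : ℚ)) i * gBinom (-(q : ℚ)) (2 * m + 3) (2 * i + 2)
        * gBinom (-(q : ℚ)) (2 * m - 2 * i) k

/-- The Gaussian binomial coefficient defined by the `q`-Pascal rule; it vanishes for `k > n`. -/
def qPascal (t : ℚ) : ℕ → ℕ → ℚ
  | _, 0 => 1
  | 0, _ + 1 => 0
  | n + 1, k + 1 => qPascal t n k + t ^ (k + 1) * qPascal t n (k + 1)

/-- The `q`-Pochhammer symbol `(t; t²)_j = ∏_{i < j} (1 - t^{2i+1})`. -/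
def oddPoch (t : ℚ) (j : ℕ) : ℚ := ∏ i ∈ Finset.range j, (1 - t ^ (2 * i + 1))

@[simp] lemma qPascal_zero_right (t : ℚ) (n : ℕ) : qPascal t n 0 = 1 := by
  cases n <;> rfl

lemma qPascal_succ_succ (t : ℚ) (n k : ℕ) :
    qPascal t (n + 1) (k + 1) = qPascal t n k + t ^ (k + 1) * qPascal t n (k + 1) := rfl

lemma qPascal_eq_zero (t : ℚ) {n k : ℕ} (h : n < k) : qPascal t n k = 0 := by
  induction n generalizing k with
  | zero => obtain ⟨k, rfl⟩ := Nat.exists_eq_succ_of_ne_zero (by omega : k ≠ 0); rfl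
  | succ n ih =>
    obtain ⟨k, rfl⟩ := Nat.exists_eq_succ_of_ne_zero (by omega : k ≠ 0)
    rw [Nat.succ_eq_add_one, qPascal_succ_succ, ih (by omega), ih (by omega)]
    ring

lemma qPascal_self (t : ℚ) (n : ℕ) : qPascal t n n = 1 := by
  induction n with
  | zero => rfl
  | succ n ih => rw [qPascal_succ_succ, ih, qPascal_eq_zero t (Nat.lt_succ_self n)]; ring

lemma gFact_succ (t : ℚ) (n : ℕ) : gFact t (n + 1) = gFact t n * gInt t (n + 1) := by
  simp [gFact, Finset.prod_range_succ]

@[simp] lemma gFact_zero (t : ℚ) : gFact t 0 = 1 := by simp [gFact]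

lemma gInt_add (t : ℚ) (a b : ℕ) : gInt t (a + b) = gInt t a + t ^ a * gInt t b := by
  simp only [gInt, pow_add]; ring

lemma qPascal_mul_gFact (t : ℚ) (a b : ℕ) :
    qPascal t (a + b) a * (gFact t a * gFact t b) = gFact t (a + b) := by
  induction a generalizing b with
  | zero => simp
  | succ a iha =>
    induction b with
    | zero => simp [qPascal_self]
    | succ b ihb =>
      have h := iha (b + 1)
      rw [show a + 1 + (b + 1) = (a + 1 + b) + 1 by ring, qPascal_succ_succ,
        gFact_succ t (a + 1 + b), show a + 1 + b + 1 = (a + 1) + (b + 1) by ring, gInt_add]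
      rw [show a + (b + 1) = a + 1 + b by ring] at h
      rw [gFact_succ t b] at h ⊢
      rw [gFact_succ t a] at ihb ⊢
      linear_combination gInt t (a + 1) * h + t ^ (a + 1) * gInt t (b + 1) * ihb

section NonRootOfUnity

variable {t : ℚ} (ht : ∀ n : ℕ, t ^ (n + 1) ≠ 1)
include ht

lemma one_sub_ne_zero : 1 - t ≠ 0 := by
  have := ht 0
  rw [zero_add, pow_one] at this
  exact sub_ne_zero.mpr this.symm

lemma gFact_ne_zero (n : ℕ) : gFact t n ≠ 0 :=
  Finset.prod_ne_zero_iff.mpr fun i _ =>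
    div_ne_zero (sub_ne_zero.mpr (ht i).symm) (one_sub_ne_zero ht)

lemma gBinom_eq_qPascal {n k : ℕ} (h : k ≤ n) : gBinom t n k = qPascal t n k := by
  obtain ⟨b, rfl⟩ := Nat.exists_eq_add_of_le h
  rw [gBinom, Nat.add_sub_cancel_left, ← qPascal_mul_gFact]
  exact mul_div_cancel_right₀ _ (mul_ne_zero (gFact_ne_zero ht _) (gFact_ne_zero ht _))

lemma qPascal_symm (a b : ℕ) : qPascal t (a + b) a = qPascal t (a + b) b := by
  have h₁ := qPascal_mul_gFact t a b
  have h₂ := qPascal_mul_gFact t b a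
  rw [add_comm b a] at h₂
  apply mul_right_cancel₀ (mul_ne_zero (gFact_ne_zero ht a) (gFact_ne_zero ht b))
  linear_combination h₁ - h₂

lemma qPascal_succ_succ' {n k : ℕ} (h : k ≤ n) :
    qPascal t (n + 1) (k + 1) = qPascal t n (k + 1) + t ^ (n - k) * qPascal t n k := by
  obtain ⟨b, rfl⟩ := Nat.exists_eq_add_of_le h
  rw [Nat.add_sub_cancel_left]
  have e : k + b + 1 = k + 1 + b := by ring
  cases b with
  | zero => simp [qPascal_self, qPascal_eq_zero t (Nat.lt_succ_self k)]
  | succ b =>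
    have h₁ := qPascal_symm ht (k + 1) (b + 1)
    have h₂ := qPascal_symm ht (k + 1) b
    have h₃ := qPascal_symm ht k (b + 1)
    rw [show k + 1 + (b + 1) = k + (b + 1) + 1 by ring, qPascal_succ_succ t _ b] at h₁
    rw [show k + 1 + b = k + (b + 1) by ring] at h₂
    rw [h₁, h₂, h₃]

lemma one_sub_pow_mul_qPascal (n k : ℕ) :
    (1 - t ^ (k + 1)) * qPascal t (n + 1) (k + 1) = (1 - t ^ (n + 1)) * qPascal t n k := by
  rcases lt_or_ge n k with h | h
  · rw [qPascal_eq_zero t h, qPascal_eq_zero t (Nat.succ_lt_succ h)]; ring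
  · have h₁ := qPascal_succ_succ t n k
    have h₂ := qPascal_succ_succ' ht h
    have h₃ : t ^ (n + 1) = t ^ (k + 1) * t ^ (n - k) := by rw [← pow_add]; congr 1; omega
    rw [h₃]
    linear_combination h₁ - t ^ (k + 1) * h₂

lemma qPascal_mul_qPascal_comm {N a k : ℕ} :
    qPascal t N a * qPascal t (N - a) k = qPascal t N k * qPascal t (N - k) a := by
  rcases lt_or_ge N (a + k) with h | h
  · have aux : ∀ {x y : ℕ}, N < x + y → qPascal t N x * qPascal t (N - x) y = 0 := by
      intro x y hxy
      rcases lt_or_ge N x with hx | hx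
      · rw [qPascal_eq_zero t hx, zero_mul]
      · rw [qPascal_eq_zero t (by omega : N - x < y), mul_zero]
    rw [aux h, aux (by omega)]
  · obtain ⟨c, rfl⟩ := Nat.exists_eq_add_of_le h
    have h₁ := qPascal_mul_gFact t a (k + c)
    have h₂ := qPascal_mul_gFact t k c
    have h₃ := qPascal_mul_gFact t k (a + c)
    have h₄ := qPascal_mul_gFact t a c
    rw [show a + k + c - a = k + c by omega, show a + k + c - k = a + c by omega]
    rw [← h₂, show a + (k + c) = a + k + c by ring] at h₁
    rw [← h₄, show k + (a + c) = a + k + c by ring] at h₃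
    apply mul_right_cancel₀ (mul_ne_zero (mul_ne_zero (gFact_ne_zero ht a) (gFact_ne_zero ht k))
      (gFact_ne_zero ht c))
    linear_combination h₁ - h₃

lemma sum_oddPoch_mul_qPascal {L R : ℕ} (h : L < 2 * R) :
    ∑ j ∈ Finset.range R,
      oddPoch t j * qPascal t L (2 * j) * t ^ (Nat.choose (L - 2 * j) 2) = 1 := by
  induction L using Nat.strong_induction_on generalizing R with
  | _ L ih =>
    obtain ⟨R, rfl⟩ := Nat.exists_eq_succ_of_ne_zero (by omega : R ≠ 0)
    rw [Nat.succ_eq_add_one] at h ⊢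
    rcases lt_or_ge L 2 with hL | hL
    · rw [Finset.sum_range_succ', Finset.sum_eq_zero fun j _ => by
        rw [qPascal_eq_zero t (by omega : L < 2 * (j + 1))]; ring]
      simp [oddPoch, Nat.choose_eq_zero_of_lt hL]
    · obtain ⟨L, rfl⟩ := Nat.exists_eq_add_of_le' hL
      have h₀ := ih L (by omega) (R := R) (by omega)
      have h₁ := ih (L + 1) (by omega) (R := R + 1) (by omega)
      rw [Finset.sum_range_succ'] at h₁ ⊢
      have key : ∀ j ∈ Finset.range R,
          oddPoch t (j + 1) * qPascal t (L + 2) (2 * (j + 1)) *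
              t ^ (Nat.choose (L + 2 - 2 * (j + 1)) 2) =
            t ^ (L + 1) * (oddPoch t (j + 1) * qPascal t (L + 1) (2 * (j + 1)) *
              t ^ (Nat.choose (L + 1 - 2 * (j + 1)) 2)) +
            (1 - t ^ (L + 1)) * (oddPoch t j * qPascal t L (2 * j) *
              t ^ (Nat.choose (L - 2 * j) 2)) := by
        intro j _
        have hp : oddPoch t (j + 1) = oddPoch t j * (1 - t ^ (2 * j + 1)) := by
          simp [oddPoch, Finset.prod_range_succ]
        have hb := one_sub_pow_mul_qPascal ht L (2 * j)
        have hs := qPascal_succ_succ t (L + 1) (2 * j + 1)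
        have he : t ^ (2 * j + 2) * qPascal t (L + 1) (2 * j + 2) * t ^ (Nat.choose (L - 2 * j) 2) =
            t ^ (L + 1) * (qPascal t (L + 1) (2 * j + 2) *
              t ^ (Nat.choose (L + 1 - (2 * j + 2)) 2)) := by
          rcases lt_or_ge (L + 1) (2 * j + 2) with hlt | hge
          · rw [qPascal_eq_zero t hlt]; ring
          · obtain ⟨d, rfl⟩ : ∃ d, L = 2 * j + 1 + d := ⟨L - (2 * j + 1), by omega⟩
            rw [show 2 * j + 1 + d - 2 * j = d + 1 by omega,
              show 2 * j + 1 + d + 1 - (2 * j + 2) = d by omega, Nat.choose_succ_succ' d 1,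
              Nat.choose_one_right]
            simp only [pow_add]; ring
        rw [show 2 * (j + 1) = 2 * j + 2 by ring, show L + 2 - (2 * j + 2) = L - 2 * j by omega,
          show L + 2 = L + 1 + 1 from rfl, show 2 * j + 2 = 2 * j + 1 + 1 from rfl, hs, hp]
        linear_combination oddPoch t j * t ^ (Nat.choose (L - 2 * j) 2) * hb +
          oddPoch t j * (1 - t ^ (2 * j + 1)) * he
      rw [Finset.sum_congr rfl key, Finset.sum_add_distrib, ← Finset.mul_sum, ← Finset.mul_sum, h₀]
      simp only [mul_zero, Nat.sub_zero, qPascal_zero_right] at h₁ ⊢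
      have hc : t ^ (Nat.choose (L + 2) 2) = t ^ (L + 1) * t ^ (Nat.choose (L + 1) 2) := by
        rw [Nat.choose_succ_succ' (L + 1) 1, Nat.choose_one_right, pow_add]
      rw [hc]
      linear_combination t ^ (L + 1) * h₁

end NonRootOfUnity

/-- The Betti sum as a single sum of `q`-Pascal coefficients over a range independent of `k`. -/
def bettiSum (t : ℚ) (m k : ℕ) : ℚ :=
  ∑ j ∈ Finset.range (m + 2), oddPoch t j * t ^ (Nat.choose (2 * m + 3 - 2 * j - k) 2) *
    qPascal t (2 * m + 3) (2 * j) * qPascal t (2 * m + 2 - 2 * j) k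

lemma oddPoch_succ_eq {t : ℚ} (h : 1 - t ≠ 0) (i : ℕ) :
    oddPoch t (i + 1) = (1 - t) ^ (i + 1) * gDFac t i := by
  rw [oddPoch, gDFac, Finset.pow_eq_prod_const, ← Finset.prod_mul_distrib]
  exact Finset.prod_congr rfl fun i _ => by rw [gInt, mul_div_cancel₀ _ h]

lemma neg_natCast_pow_ne_one {q : ℕ} (hq : 2 ≤ q) (n : ℕ) : (-(q : ℚ)) ^ (n + 1) ≠ 1 := by
  intro h
  have h₁ := congrArg abs h
  rw [abs_pow, abs_neg, Nat.abs_cast, abs_one] at h₁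
  have h₂ : (1 : ℚ) < q := by exact_mod_cast hq
  exact (one_lt_pow₀ h₂ n.succ_ne_zero).ne' h₁

lemma fanoBetti_eq_bettiSum {q m k : ℕ} (hq : 2 ≤ q) (hk : k ≤ 2 * m + 2) :
    fanoBetti q m k = bettiSum (-(q : ℚ)) m k := by
  have ht := neg_natCast_pow_ne_one hq
  rw [fanoBetti, bettiSum, Finset.sum_range_succ', add_comm, gBinom_eq_qPascal ht hk]
  congr 1
  · rw [← Finset.sum_subset (Finset.range_mono (by omega : m + 1 - (k + 1) / 2 ≤ m + 1))]
    · refine Finset.sum_congr rfl fun i hi => ?_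
      rw [Finset.mem_range] at hi
      rw [oddPoch_succ_eq (one_sub_ne_zero ht), gBinom_eq_qPascal ht (by omega),
        gBinom_eq_qPascal ht (by omega), show 2 * m + 3 - 2 * (i + 1) = 2 * m + 1 - 2 * i by omega,
        show 2 * m + 2 - 2 * (i + 1) = 2 * m - 2 * i by omega, show 2 * (i + 1) = 2 * i + 2 by ring]
      ring
    · intro i hi hi'
      rw [Finset.mem_range] at hi hi'
      rw [qPascal_eq_zero _ (by omega : 2 * m + 2 - 2 * (i + 1) < k), mul_zero]
  · simp [oddPoch]

lemma bettiSum_top (t : ℚ) (m : ℕ) : bettiSum t m (2 * m + 2) = 1 := by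
  rw [bettiSum, Finset.sum_range_succ', Finset.sum_eq_zero fun j _ => by
    rw [qPascal_eq_zero t (by omega : 2 * m + 2 - 2 * (j + 1) < 2 * m + 2), mul_zero]]
  simp [oddPoch, qPascal_self, show 2 * m + 3 - (2 * m + 2) = 1 by omega]

section BettiSum

variable {t : ℚ} (ht : ∀ n : ℕ, t ^ (n + 1) ≠ 1)
include ht

lemma bettiSum_zero (m : ℕ) : bettiSum t m 0 = 1 := by
  rw [← sum_oddPoch_mul_qPascal ht (by omega : 2 * m + 3 < 2 * (m + 2)), bettiSum]
  refine Finset.sum_congr rfl fun j _ => ?_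
  rw [qPascal_zero_right, Nat.sub_zero]
  ring

lemma bettiSum_add_succ (m k : ℕ) :
    bettiSum t m k + bettiSum t m (k + 1) = qPascal t (2 * m + 3) (k + 1) := by
  have h := sum_oddPoch_mul_qPascal ht (by omega : 2 * m + 3 - (k + 1) < 2 * (m + 2))
  rw [← mul_one (qPascal t (2 * m + 3) (k + 1)), ← h, Finset.mul_sum, bettiSum, bettiSum,
    ← Finset.sum_add_distrib]
  refine Finset.sum_congr rfl fun j hj => ?_
  rw [Finset.mem_range] at hj
  have hc := qPascal_mul_qPascal_comm ht (N := 2 * m + 3) (a := 2 * j) (k := k + 1)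
  obtain ⟨M, hM⟩ : ∃ M, 2 * m + 2 = M + 2 * j := ⟨2 * m + 2 - 2 * j, by omega⟩
  rw [show 2 * m + 3 - 2 * j = M + 1 by omega] at hc ⊢
  rw [show 2 * m + 2 - 2 * j = M by omega, show M + 1 - (k + 1) = M - k by omega,
    show 2 * m + 3 - (k + 1) - 2 * j = M - k by omega]
  have hp : t ^ (Nat.choose (M + 1 - k) 2) * qPascal t M k +
      t ^ (Nat.choose (M - k) 2) * qPascal t M (k + 1) =
      t ^ (Nat.choose (M - k) 2) * qPascal t (M + 1) (k + 1) := by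
    rcases lt_or_ge M k with hlt | hge
    · rw [qPascal_eq_zero t hlt, qPascal_eq_zero t (Nat.lt_succ_of_lt hlt),
        qPascal_eq_zero t (Nat.succ_lt_succ hlt)]
      ring
    · rw [qPascal_succ_succ' ht hge, Nat.succ_sub hge, Nat.choose_succ_succ' (M - k) 1,
        Nat.choose_one_right, pow_add]
      ring
  linear_combination oddPoch t j * qPascal t (2 * m + 3) (2 * j) * hp +
    oddPoch t j * t ^ (Nat.choose (M - k) 2) * hc

lemma bettiSum_symm {m k : ℕ} (hk : k ≤ 2 * m + 2) :
    bettiSum t m k = bettiSum t m (2 * m + 2 - k) := by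
  induction k with
  | zero => rw [bettiSum_zero ht, Nat.sub_zero, bettiSum_top]
  | succ k ih =>
    obtain ⟨l, hl⟩ : ∃ l, 2 * m + 2 = l + (k + 1) := ⟨2 * m + 2 - (k + 1), by omega⟩
    have h := ih (by omega)
    rw [show 2 * m + 2 - k = l + 1 by omega] at h
    rw [show 2 * m + 2 - (k + 1) = l by omega]
    have hs := qPascal_symm ht (k + 1) (l + 1)
    rw [show k + 1 + (l + 1) = 2 * m + 3 by omega] at hs
    linear_combination bettiSum_add_succ ht m k - bettiSum_add_succ ht m l + hs - h

lemma bettiSum_one (m : ℕ) : bettiSum t m 1 = t * gInt t (2 * m + 2) := by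
  have h := bettiSum_add_succ ht m 0
  have hf := qPascal_mul_gFact t 1 (2 * m + 2)
  have h₁ : gInt t 1 = 1 := by rw [gInt, pow_one, div_self (one_sub_ne_zero ht)]
  rw [add_comm 1, gFact_succ t (2 * m + 2), gFact_succ t 0, gFact_zero, zero_add, h₁] at hf
  have hN : qPascal t (2 * m + 3) 1 = gInt t (2 * m + 3) := by
    apply mul_right_cancel₀ (gFact_ne_zero ht (2 * m + 2))
    linear_combination hf
  rw [bettiSum_zero ht, zero_add, hN, show 2 * m + 3 = 1 + (2 * m + 2) by ring, gInt_add, h₁] at h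
  linear_combination h

end BettiSum

/-- Poincaré duality for the Betti numbers of the Fano scheme:
`b_k = b_{2m+2-k}` for 0 ≤ k ≤ 2m+2; in particular `b_1 = b_{2m+1} = q̄·[2m+2]_{q̄}`. -/
theorem stmt_17 {q m : ℕ} (hq : 2 ≤ q) :
    (∀ k ≤ 2 * m + 2, fanoBetti q m k = fanoBetti q m (2 * m + 2 - k)) ∧
    fanoBetti q m 1 = (-(q : ℚ)) * gInt (-(q : ℚ)) (2 * m + 2) := by
  have ht := neg_natCast_pow_ne_one hq
  refine ⟨fun k hk => ?_, ?_⟩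
  · rw [fanoBetti_eq_bettiSum hq hk, fanoBetti_eq_bettiSum hq (Nat.sub_le _ _), bettiSum_symm ht hk]
  · rw [fanoBetti_eq_bettiSum hq (by omega), bettiSum_one ht]
end
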